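/- Let c be a real number with 1 < c < 4109054/1999527 and c ≠ 2, let ε > 0 be fixed and sufficiently small, let P be sufficiently large, τ = P^{1-c-ε}, and let X satisfy P^{9449/10000} ≪ X ≪ P. Set H = X^{38687/2666036}. Let (c_h(α)) be complex numbers with |c_h(α)| ≪ (1 + |h|)^{-1}, let a(m), b(k) be complex coefficients with a(m) ≪ m^{ε} and b(k) ≪ k^{ε}, and let M, K satisfy MK ≍ X and X^{38687/1333018} ≪ M ≪ X^{11958325/23994324}. Then for every α ∈ (τ, 1-τ), the Type II sum S_{II}(α) = Σ_{|h| ≤ H} c_h(α) Σ_{M < m ≤ 2M} a(m) Σ_{K < k ≤ 2K} b(k) e((h+α)(mk)^c) satisfies S_{II}(α) ≪ X^{2627349/2666036 + ε}. -/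

import Mathlib

open scoped Classical
open Finset Real

/-- `eC x = e(x) = e^{2πix}`. -/
noncomputable def eC (x : ℝ) : ℂ := Complex.exp ((2 * Real.pi * x : ℝ) * Complex.I)

lemma norm_eC (x : ℝ) : ‖eC x‖ = 1 := Complex.norm_exp_ofReal_mul_I _

lemma eC_add (x y : ℝ) : eC (x + y) = eC x * eC y := by
  rw [eC, eC, eC, ← Complex.exp_add]
  congr 1
  push_cast
  ring

lemma conj_eC (x : ℝ) : (starRingEnd ℂ) (eC x) = eC (-x) := by
  rw [eC, eC, ← Complex.exp_conj]
  rw [map_mul, Complex.conj_ofReal, Complex.conj_I]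
  push_cast
  ring_nf

lemma eC_mul_conj (x y : ℝ) : eC x * (starRingEnd ℂ) (eC y) = eC (x - y) := by
  rw [conj_eC, ← eC_add, sub_eq_add_neg]

lemma eC_int (n : ℤ) : eC n = 1 := by
  rw [eC, Complex.exp_eq_one_iff]
  exact ⟨n, by push_cast; ring⟩

lemma norm_sum_eC_neg {ι : Type*} (s : Finset ι) (f : ι → ℝ) :
    ‖∑ n ∈ s, eC (-f n)‖ = ‖∑ n ∈ s, eC (f n)‖ := by
  rw [← RCLike.norm_conj (∑ n ∈ s, eC (f n)), map_sum]
  simp only [conj_eC]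

lemma norm_sum_eC_le {ι : Type*} (s : Finset ι) (f : ι → ℝ) :
    ‖∑ n ∈ s, eC (f n)‖ ≤ #s := by
  refine (norm_sum_le _ _).trans ?_
  simp [norm_eC]

lemma eC_sub_one (g : ℝ) :
    eC g - 1 = 2 * Complex.I * (Real.sin (π * g) : ℂ) *
      ((Real.cos (π * g) : ℂ) + (Real.sin (π * g) : ℂ) * Complex.I) := by
  have h : eC g = (Real.cos (2 * (π * g)) : ℂ) + (Real.sin (2 * (π * g)) : ℂ) * Complex.I := by
    rw [eC, Complex.exp_mul_I, Complex.ofReal_cos, Complex.ofReal_sin, ← mul_assoc]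
  rw [h, Real.cos_two_mul, Real.sin_two_mul]
  have h2 : (Real.sin (π * g) : ℂ) ^ 2 + (Real.cos (π * g) : ℂ) ^ 2 = 1 := by
    exact_mod_cast Real.sin_sq_add_cos_sq (π * g)
  push_cast at h2 ⊢
  linear_combination 2 * h2 - (2 * Complex.sin (π * g) ^ 2) * Complex.I_sq

/-- The inverse of `e(g) - 1`, written with the cotangent. -/
noncomputable def eCInv (g : ℝ) : ℂ :=
  -(1 / 2 : ℂ) - ((Real.cot (π * g) / 2 : ℝ) : ℂ) * Complex.I

lemma eC_sub_one_mul_eCInv {g : ℝ} (hg : Real.sin (π * g) ≠ 0) :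
    (eC g - 1) * eCInv g = 1 := by
  rw [eC_sub_one, eCInv, Real.cot_eq_cos_div_sin]
  have h2 : (Real.sin (π * g) : ℂ) ^ 2 + (Real.cos (π * g) : ℂ) ^ 2 = 1 := by
    exact_mod_cast Real.sin_sq_add_cos_sq (π * g)
  have h3 : (Real.sin (π * g) : ℂ) ≠ 0 := by exact_mod_cast hg
  have h4 : ((Real.cos (π * g) / Real.sin (π * g) / 2 : ℝ) : ℂ) =
    (Real.cos (π * g) : ℂ) / (Real.sin (π * g) : ℂ) / 2 := by push_cast; rfl
  rw [h4]
  generalize (Real.sin (π * g) : ℂ) = s at *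
  generalize (Real.cos (π * g) : ℂ) = t at *
  field_simp
  have := Complex.I_sq
  linear_combination h2 + (-t ^ 2 - s ^ 2 - s * t * Complex.I) * this

lemma cot_sub_cot_nonneg {x y : ℝ} (hx : 0 < x) (hxy : x ≤ y) (hy : y < π) :
    0 ≤ Real.cot x - Real.cot y := by
  have h1 := Real.sin_pos_of_pos_of_lt_pi hx (hxy.trans_lt hy)
  have h2 := Real.sin_pos_of_pos_of_lt_pi (hx.trans_le hxy) hy
  have h3 := Real.sin_nonneg_of_nonneg_of_le_pi (sub_nonneg.2 hxy) (by linarith)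
  rw [Real.sin_sub] at h3
  rw [Real.cot_eq_cos_div_sin, Real.cot_eq_cos_div_sin, div_sub_div _ _ h1.ne' h2.ne']
  apply div_nonneg _ (by positivity)
  linarith

lemma two_mul_le_sin_pi_mul {θ g : ℝ} (hθ : 0 < θ) (h1 : θ ≤ g) (h2 : g ≤ 1 - θ) :
    2 * θ ≤ Real.sin (π * g) := by
  have hpi := Real.pi_pos
  rcases le_total g (1 / 2) with h | h
  · have := Real.mul_le_sin (x := π * g) (mul_nonneg hpi.le (by linarith)) (by nlinarith)
    have e : 2 / π * (π * g) = 2 * g := by field_simp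
    linarith
  · have := Real.mul_le_sin (x := π * (1 - g)) (by apply mul_nonneg <;> linarith) (by nlinarith)
    have e : 2 / π * (π * (1 - g)) = 2 * (1 - g) := by field_simp
    have e2 : Real.sin (π * (1 - g)) = Real.sin (π * g) := by
      rw [mul_sub, mul_one, Real.sin_pi_sub]
    linarith

lemma norm_eCInv_le {θ g : ℝ} (hθ : 0 < θ) (h1 : θ ≤ g) (h2 : g ≤ 1 - θ) :
    ‖eCInv g‖ ≤ 1 / (4 * θ) := by
  have hs := two_mul_le_sin_pi_mul hθ h1 h2
  have hs0 : 0 < Real.sin (π * g) := by linarith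
  have h := congrArg norm (eC_sub_one_mul_eCInv hs0.ne')
  rw [norm_mul, norm_one] at h
  have h3 : ‖eC g - 1‖ = 2 * Real.sin (π * g) := by
    have e : ((Real.cos (π * g) : ℂ) + (Real.sin (π * g) : ℂ) * Complex.I) = eC (g / 2) := by
      rw [eC, Complex.exp_mul_I, Complex.ofReal_cos, Complex.ofReal_sin]
      have : 2 * π * (g / 2) = π * g := by ring
      rw [this]
    rw [eC_sub_one, e, norm_mul, norm_eC, norm_mul, Complex.norm_real, Real.norm_of_nonneg hs0.le]
    simp
  rw [h3] at h
  rw [le_div_iff₀ (by positivity)]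
  nlinarith [norm_nonneg (eCInv g)]

lemma abs_cot_le {θ g : ℝ} (hθ : 0 < θ) (h1 : θ ≤ g) (h2 : g ≤ 1 - θ) :
    |Real.cot (π * g)| ≤ 1 / (2 * θ) := by
  have hs := two_mul_le_sin_pi_mul hθ h1 h2
  rw [Real.cot_eq_cos_div_sin, abs_div, abs_of_pos (by linarith : 0 < Real.sin (π * g))]
  exact div_le_div₀ zero_le_one (Real.abs_cos_le_one _) (by linarith) hs

/-- Discrete Kusmin-Landau inequality. -/
lemma kusmin_landau (f : ℕ → ℝ) (N : ℕ) (θ : ℝ) (ν : ℤ) (hθ : 0 < θ)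
    (hmono : ∀ n, n + 1 < N → f (n + 1) - f n ≤ f (n + 2) - f (n + 1))
    (hlow : ∀ n < N, ν + θ ≤ f (n + 1) - f n)
    (hup : ∀ n < N, f (n + 1) - f n ≤ ν + 1 - θ) :
    ‖∑ n ∈ range N, eC (f n)‖ ≤ 1 / θ := by
  obtain ⟨F, hF⟩ : ∃ F : ℕ → ℝ, ∀ n, F n = f n - ν * n := ⟨_, fun _ => rfl⟩
  have heF : ∀ n, eC (f n) = eC (F n) := fun n => by
    have : f n = F n + ((ν * n : ℤ) : ℝ) := by rw [hF]; push_cast; ring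
    rw [this, eC_add, eC_int, mul_one]
  obtain ⟨g, hg⟩ : ∃ g : ℕ → ℝ, ∀ n, g n = F (n + 1) - F n := ⟨_, fun _ => rfl⟩
  have hgf : ∀ n, g n = f (n + 1) - f n - ν := fun n => by
    rw [hg, hF, hF]; push_cast; ring
  have hg1 : ∀ n < N, θ ≤ g n := fun n hn => by rw [hgf]; linarith [hlow n hn]
  have hg2 : ∀ n < N, g n ≤ 1 - θ := fun n hn => by rw [hgf]; linarith [hup n hn]
  have hgm : ∀ n, n + 1 < N → g n ≤ g (n + 1) := fun n hn => by
    rw [hgf, hgf]; linarith [hmono n hn]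
  simp only [heF]
  have hpi := Real.pi_pos
  have key : ∀ m, m + 1 ≤ N → ‖∑ n ∈ range (m + 1), eC (F n) - eC (F (m + 1)) * eCInv (g m)‖ ≤
      ‖eCInv (g 0)‖ + (Real.cot (π * g 0) - Real.cot (π * g m)) / 2 := by
    intro m
    induction m with
    | zero =>
      intro hN
      have hs : Real.sin (π * g 0) ≠ 0 := by
        have := two_mul_le_sin_pi_mul hθ (hg1 0 (by omega)) (hg2 0 (by omega))
        linarith
      have h := eC_sub_one_mul_eCInv hs
      have h2 : eC (F 1) = eC (F 0) * eC (g 0) := by rw [← eC_add, hg]; congr 1; ring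
      have : ∑ n ∈ range (0 + 1), eC (F n) - eC (F (0 + 1)) * eCInv (g 0) =
          -(eC (F 0) * eCInv (g 0)) := by
        simp only [zero_add, sum_range_one]
        rw [h2]
        linear_combination (-eC (F 0)) * h
      rw [this, norm_neg, norm_mul, norm_eC]
      simp
    | succ m ih =>
      intro hN
      have hs : Real.sin (π * g (m + 1)) ≠ 0 := by
        have := two_mul_le_sin_pi_mul hθ (hg1 (m + 1) (by omega)) (hg2 (m + 1) (by omega))
        linarith
      have h := eC_sub_one_mul_eCInv hs
      have h2 : eC (F (m + 2)) = eC (F (m + 1)) * eC (g (m + 1)) := by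
        rw [← eC_add, hg]; congr 1; ring
      have h3 : ∑ n ∈ range (m + 1 + 1), eC (F n) - eC (F (m + 1 + 1)) * eCInv (g (m + 1)) =
          (∑ n ∈ range (m + 1), eC (F n) - eC (F (m + 1)) * eCInv (g m)) +
          eC (F (m + 1)) * (eCInv (g m) - eCInv (g (m + 1))) := by
        rw [sum_range_succ _ (m + 1)]
        rw [h2]
        linear_combination (-eC (F (m + 1))) * h
      have h4 : ‖eCInv (g m) - eCInv (g (m + 1))‖ =
          (Real.cot (π * g m) - Real.cot (π * g (m + 1))) / 2 := by
        have hc : 0 ≤ Real.cot (π * g m) - Real.cot (π * g (m + 1)) := by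
          apply cot_sub_cot_nonneg
          · have := hg1 m (by omega)
            exact mul_pos hpi (by linarith)
          · exact mul_le_mul_of_nonneg_left (hgm m (by omega)) hpi.le
          · have := hg2 (m + 1) (by omega)
            nlinarith
        have : eCInv (g m) - eCInv (g (m + 1)) =
            ((-((Real.cot (π * g m) - Real.cot (π * g (m + 1))) / 2) : ℝ) : ℂ) * Complex.I := by
          simp only [eCInv]; push_cast; ring
        rw [this, norm_mul, Complex.norm_I, mul_one, Complex.norm_real, norm_neg,
          Real.norm_of_nonneg (by linarith)]
      rw [h3]
      refine (norm_add_le _ _).trans ?_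
      rw [norm_mul, norm_eC, one_mul, h4]
      linarith [ih (by omega)]
  rcases N with _ | m
  · simp; positivity
  · have h1 := key m le_rfl
    have h2 := norm_le_norm_sub_add (∑ n ∈ range (m + 1), eC (F n)) (eC (F (m + 1)) * eCInv (g m))
    rw [norm_mul, norm_eC, one_mul] at h2
    have h3 := norm_eCInv_le hθ (hg1 0 (by omega)) (hg2 0 (by omega))
    have h4 := norm_eCInv_le hθ (hg1 m (by omega)) (hg2 m (by omega))
    have h5 := abs_le.1 (abs_cot_le hθ (hg1 0 (by omega)) (hg2 0 (by omega)))
    have h6 := abs_le.1 (abs_cot_le hθ (hg1 m (by omega)) (hg2 m (by omega)))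
    have e1 : 1 / (4 * θ) = 1 / θ / 4 := by field_simp
    have e2 : 1 / (2 * θ) = 1 / θ / 2 := by field_simp
    rw [e1] at h3 h4
    rw [e2] at h5 h6
    linarith [h5.1, h5.2, h6.1, h6.2]

lemma exists_eq_Ico_of_ordConnected (S : Finset ℕ)
    (h : ∀ a ∈ S, ∀ b ∈ S, ∀ n, a ≤ n → n ≤ b → n ∈ S) :
    ∃ a L : ℕ, S = Ico a (a + L) := by
  rcases S.eq_empty_or_nonempty with rfl | hS
  · exact ⟨0, 0, by simp⟩
  · refine ⟨S.min' hS, S.max' hS + 1 - S.min' hS, ?_⟩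
    have h1 := S.min'_le _ (S.max'_mem hS)
    ext n
    rw [mem_Ico]
    constructor
    · intro hn
      have := S.min'_le n hn
      have := S.le_max' n hn
      omega
    · intro hn
      exact h _ (S.min'_mem hS) _ (S.max'_mem hS) n hn.1 (by omega)

lemma card_le_of_spread (S : Finset ℕ) (lam θ : ℝ) (hlam : 0 < lam) (hθ : 0 ≤ θ)
    (h : ∀ a ∈ S, ∀ b ∈ S, a ≤ b → ((b : ℝ) - a) * lam ≤ θ) : (#S : ℝ) ≤ θ / lam + 1 := by
  rcases S.eq_empty_or_nonempty with rfl | hS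
  · simp; positivity
  · have h1 := S.min'_le _ (S.max'_mem hS)
    have h2 := h _ (S.min'_mem hS) _ (S.max'_mem hS) h1
    have h3 : #S ≤ #(Icc (S.min' hS) (S.max' hS)) := card_le_card fun n hn =>
      mem_Icc.2 ⟨S.min'_le n hn, S.le_max' n hn⟩
    rw [Nat.card_Icc] at h3
    have h4 : (#S : ℝ) ≤ (S.max' hS : ℝ) + 1 - S.min' hS := by
      have : #S + S.min' hS ≤ S.max' hS + 1 := by omega
      have : (#S : ℝ) + S.min' hS ≤ S.max' hS + 1 := by exact_mod_cast this
      linarith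
    rw [← le_div_iff₀ hlam] at h2
    linarith

lemma norm_sum_fiber_le (f : ℕ → ℝ) (N : ℕ) (lam θ : ℝ) (ν : ℤ) (hlam : 0 < lam) (hθ : 0 < θ)
    (hinc : ∀ a b, a ≤ b → b < N →
      ((b : ℝ) - a) * lam ≤ (f (b + 1) - f b) - (f (a + 1) - f a)) :
    ‖∑ n ∈ range N with ⌊f (n + 1) - f n⌋ = ν, eC (f n)‖ ≤ 2 * (θ / lam + 1) + 1 / θ := by
  set S := (range N).filter (fun n => ⌊f (n + 1) - f n⌋ = ν) with hS
  have hmem : ∀ n, n ∈ S ↔ n < N ∧ (ν : ℝ) ≤ f (n + 1) - f n ∧ f (n + 1) - f n < ν + 1 := by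
    intro n
    rw [hS, mem_filter, mem_range, Int.floor_eq_iff]
  have hmono : ∀ a b, a ≤ b → b < N → f (a + 1) - f a ≤ f (b + 1) - f b := fun a b hab hb => by
    have h1 := hinc a b hab hb
    have h2 : (0 : ℝ) ≤ ((b : ℝ) - a) * lam :=
      mul_nonneg (sub_nonneg.2 (by exact_mod_cast hab)) hlam.le
    linarith
  have hlow : (#(S.filter (fun n => f (n + 1) - f n < ν + θ)) : ℝ) ≤ θ / lam + 1 := by
    apply card_le_of_spread _ _ _ hlam hθ.le
    intro a ha b hb hab
    rw [mem_filter, hmem] at ha hb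
    have := hinc a b hab hb.1.1
    linarith [ha.1.2.1, hb.2]
  have hhigh : (#((S.filter (fun n => ¬ f (n + 1) - f n < ν + θ)).filter
      (fun n => ν + 1 - θ < f (n + 1) - f n)) : ℝ) ≤ θ / lam + 1 := by
    apply card_le_of_spread _ _ _ hlam hθ.le
    intro a ha b hb hab
    rw [mem_filter, mem_filter, hmem] at ha hb
    have := hinc a b hab hb.1.1.1
    linarith [ha.2, hb.1.1.2.2]
  rw [← sum_filter_add_sum_filter_not S (fun n => f (n + 1) - f n < ν + θ),
    ← sum_filter_add_sum_filter_not (S.filter (fun n => ¬ f (n + 1) - f n < ν + θ))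
      (fun n => ν + 1 - θ < f (n + 1) - f n)]
  have hmid : ‖∑ n ∈ (S.filter (fun n => ¬ f (n + 1) - f n < ν + θ)).filter
      (fun n => ¬ ν + 1 - θ < f (n + 1) - f n), eC (f n)‖ ≤ 1 / θ := by
    set U := (S.filter (fun n => ¬ f (n + 1) - f n < ν + θ)).filter
      (fun n => ¬ ν + 1 - θ < f (n + 1) - f n) with hU
    have hUm : ∀ n, n ∈ U ↔ n < N ∧ ν + θ ≤ f (n + 1) - f n ∧ f (n + 1) - f n ≤ ν + 1 - θ := by
      intro n
      rw [hU, mem_filter, mem_filter, hmem]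
      constructor
      · rintro ⟨⟨h1, h2⟩, h3⟩
        exact ⟨h1.1, by linarith, by linarith⟩
      · rintro ⟨h1, h2, h3⟩
        refine ⟨⟨⟨h1, by linarith, by linarith⟩, by linarith⟩, by linarith⟩
    obtain ⟨a, L, haL⟩ := exists_eq_Ico_of_ordConnected U (by
      intro a ha b hb n han hnb
      rw [hUm] at ha hb ⊢
      have h1 := hmono a n han (by omega)
      have h2 := hmono n b hnb (by omega)
      exact ⟨by omega, by linarith [ha.2.1], by linarith [hb.2.2]⟩)
    have hin : ∀ n < L, a + n < N ∧ ν + θ ≤ f (a + n + 1) - f (a + n) ∧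
        f (a + n + 1) - f (a + n) ≤ ν + 1 - θ := fun n hn => by
      rw [← hUm, haL, mem_Ico]; omega
    rw [haL, sum_Ico_eq_sum_range, Nat.add_sub_cancel_left]
    apply kusmin_landau (fun n => f (a + n)) L θ ν hθ
    · intro n hn
      exact hmono (a + n) (a + n + 1) (by omega) (hin (n + 1) hn).1
    · exact fun n hn => (hin n hn).2.1
    · exact fun n hn => (hin n hn).2.2
  have h1 := norm_sum_eC_le (S.filter (fun n => f (n + 1) - f n < ν + θ)) f
  have h2 := norm_sum_eC_le ((S.filter (fun n => ¬ f (n + 1) - f n < ν + θ)).filter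
      (fun n => ν + 1 - θ < f (n + 1) - f n)) f
  refine (norm_add_le _ _).trans ?_
  have h3 := norm_add_le (∑ n ∈ (S.filter (fun n => ¬ f (n + 1) - f n < ν + θ)).filter
      (fun n => ν + 1 - θ < f (n + 1) - f n), eC (f n))
      (∑ n ∈ (S.filter (fun n => ¬ f (n + 1) - f n < ν + θ)).filter
      (fun n => ¬ ν + 1 - θ < f (n + 1) - f n), eC (f n))
  linarith

/-- The `k`-th derivative test for exponential sums, in terms of `k`-th differences, with exponents
`p`, `σ`, `r`. -/
def DifferenceTest (k : ℕ) (p σ r : ℝ) : Prop :=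
  ∀ C : ℝ, ∃ B > 0, ∀ (f : ℕ → ℝ) (N : ℕ) (lam : ℝ), 0 < lam → lam ≤ 1 →
    (∀ n < N, lam ≤ (fwdDiff 1)^[k] f n ∧ (fwdDiff 1)^[k] f n ≤ C * lam) →
    ‖∑ n ∈ range N, eC (f n)‖ ≤ B * (N * lam ^ p + (N : ℝ) ^ σ * lam ^ (-r))

lemma differenceTest_two : DifferenceTest 2 (1 / 2) 0 (1 / 2) := by
  intro C
  refine ⟨5 * |C| + 10, by positivity, fun f N lam hlam hlam1 hf => ?_⟩
  rcases Nat.eq_zero_or_pos N with rfl | hN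
  · simp; positivity
  have hf2 : ∀ n, (fwdDiff 1)^[2] f n = (f (n + 2) - f (n + 1)) - (f (n + 1) - f n) := fun n => by
    simp [fwdDiff]
  simp only [hf2] at hf
  set g : ℕ → ℝ := fun n => f (n + 1) - f n with hg
  have hinc : ∀ a b, a ≤ b → b < N → ((b : ℝ) - a) * lam ≤ g b - g a := by
    intro a b hab
    induction b, hab using Nat.le_induction with
    | base => intro _; simp
    | succ b hab ih =>
      intro hb
      have h1 := ih (by omega)
      have h2 := (hf b (by omega)).1
      simp only [hg] at h1 h2 ⊢
      push_cast
      linarith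
  have hvar : ∀ b < N, g b - g 0 ≤ b * (C * lam) := by
    intro b
    induction b with
    | zero => intro _; simp
    | succ b ih =>
      intro hb
      have h1 := ih (by omega)
      have h2 := (hf b (by omega)).2
      simp only [hg] at h1 h2 ⊢
      push_cast
      linarith
  have hmono : ∀ a b, a ≤ b → b < N → g a ≤ g b := fun a b hab hb => by
    have h1 := hinc a b hab hb
    have h2 : (0 : ℝ) ≤ ((b : ℝ) - a) * lam :=
      mul_nonneg (sub_nonneg.2 (by exact_mod_cast hab)) hlam.le
    linarith
  have hmaps : ∀ n ∈ range N, ⌊g n⌋ ∈ Icc ⌊g 0⌋ ⌊g (N - 1)⌋ := fun n hn => by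
    have hn' := mem_range.1 hn
    exact mem_Icc.2 ⟨Int.floor_le_floor (hmono 0 n (by omega) hn'),
      Int.floor_le_floor (hmono n (N - 1) (by omega) (by omega))⟩
  obtain ⟨s, hs⟩ : ∃ s, s = √lam := ⟨_, rfl⟩
  have hs0 : 0 < s := hs ▸ Real.sqrt_pos.2 hlam
  have hs2 : s * s = lam := hs ▸ Real.mul_self_sqrt hlam.le
  have hs1 : s ≤ 1 := hs ▸ Real.sqrt_le_one.2 hlam1
  rw [← sum_fiberwise_of_maps_to hmaps]
  have hfib : ∀ ν ∈ Icc ⌊g 0⌋ ⌊g (N - 1)⌋,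
      ‖∑ n ∈ range N with ⌊g n⌋ = ν, eC (f n)‖ ≤ 5 / s := fun ν _ => by
    refine (norm_sum_fiber_le f N lam (s / 2) ν hlam (by positivity) hinc).trans ?_
    rw [← hs2]
    have : 2 * (s / 2 / (s * s) + 1) + 1 / (s / 2) = (3 + 2 * s) / s := by field_simp; ring
    rw [this]
    gcongr
    linarith
  refine (norm_sum_le_of_le _ hfib).trans ?_
  rw [sum_const, nsmul_eq_mul]
  have hcard : (#(Icc ⌊g 0⌋ ⌊g (N - 1)⌋) : ℝ) ≤ |C| * lam * N + 2 := by
    rw [Int.card_Icc]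
    have h0 : ⌊g 0⌋ ≤ ⌊g (N - 1)⌋ := Int.floor_le_floor (hmono 0 (N - 1) (by omega) (by omega))
    have h1 : (((⌊g (N - 1)⌋ + 1 - ⌊g 0⌋).toNat : ℕ) : ℝ) = (⌊g (N - 1)⌋ : ℝ) + 1 - ⌊g 0⌋ := by
      have : (((⌊g (N - 1)⌋ + 1 - ⌊g 0⌋).toNat : ℕ) : ℤ) = ⌊g (N - 1)⌋ + 1 - ⌊g 0⌋ :=
        Int.toNat_of_nonneg (by omega)
      exact_mod_cast congrArg (Int.cast : ℤ → ℝ) this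
    rw [h1]
    have h2 := Int.floor_le (g (N - 1))
    have h3 := Int.lt_floor_add_one (g 0)
    have h4 := hvar (N - 1) (by omega)
    have h5 : ((N - 1 : ℕ) : ℝ) * (C * lam) ≤ N * (|C| * lam) := by
      have : ((N - 1 : ℕ) : ℝ) ≤ N := by exact_mod_cast Nat.sub_le N 1
      have h6 : C * lam ≤ |C| * lam := mul_le_mul_of_nonneg_right (le_abs_self C) hlam.le
      calc ((N - 1 : ℕ) : ℝ) * (C * lam) ≤ ((N - 1 : ℕ) : ℝ) * (|C| * lam) := by gcongr
        _ ≤ N * (|C| * lam) := by gcongr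
    linarith
  have e1 : lam ^ (1 / 2 : ℝ) = s := by rw [hs, Real.sqrt_eq_rpow]
  have e2 : lam ^ (-(1 / 2) : ℝ) = 1 / s := by rw [Real.rpow_neg hlam.le, e1, one_div]
  rw [e1, e2, Real.rpow_zero, one_mul]
  calc (#(Icc ⌊g 0⌋ ⌊g (N - 1)⌋) : ℝ) * (5 / s) ≤ (|C| * lam * N + 2) * (5 / s) := by gcongr
    _ = 5 * |C| * (N * s) + 10 * (1 / s) := by rw [← hs2]; field_simp; ring
    _ ≤ (5 * |C| + 10) * (N * s + 1 / s) := by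
      have h1 : 0 ≤ (N : ℝ) * s := by positivity
      have h2 : 0 ≤ 1 / s := by positivity
      nlinarith [abs_nonneg C, mul_nonneg (abs_nonneg C) h2]

lemma sum_range_shift (z : ℕ → ℂ) (N Q q : ℕ) (hq : q < Q) :
    ∑ m ∈ range (N + Q), (if Q ≤ m + q ∧ m + q < Q + N then z (m + q - Q) else 0) =
      ∑ n ∈ range N, z n := by
  rw [← sum_filter]
  refine sum_nbij' (fun m => m + q - Q) (fun n => n + Q - q) ?_ ?_ ?_ ?_ ?_
  all_goals intro x hx; simp only [mem_filter, mem_range] at hx ⊢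
  all_goals try omega

lemma sum_range_shift_mul (z : ℕ → ℂ) (N Q q q' : ℕ) (hqq : q' < q) (hq : q < Q) :
    ∑ m ∈ range (N + Q), (if Q ≤ m + q ∧ m + q < Q + N then z (m + q - Q) else 0) *
        (starRingEnd ℂ) (if Q ≤ m + q' ∧ m + q' < Q + N then z (m + q' - Q) else 0) =
      ∑ n ∈ range (N - (q - q')), z (n + (q - q')) * (starRingEnd ℂ) (z n) := by
  have h : ∀ m ∈ range (N + Q), (if Q ≤ m + q ∧ m + q < Q + N then z (m + q - Q) else 0) *
        (starRingEnd ℂ) (if Q ≤ m + q' ∧ m + q' < Q + N then z (m + q' - Q) else 0) =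
        if Q ≤ m + q' ∧ m + q < Q + N then
          z (m + q - Q) * (starRingEnd ℂ) (z (m + q' - Q)) else 0 := by
    intro m _
    by_cases h1 : Q ≤ m + q' ∧ m + q < Q + N
    · rw [if_pos h1, if_pos (by omega), if_pos (by omega)]
    · rw [if_neg h1]
      by_cases h2 : Q ≤ m + q ∧ m + q < Q + N
      · rw [if_neg (by omega : ¬ (Q ≤ m + q' ∧ m + q' < Q + N)), map_zero, mul_zero]
      · rw [if_neg h2, zero_mul]
  rw [sum_congr rfl h, ← sum_filter]
  refine sum_nbij' (fun m => m + q' - Q) (fun n => n + Q - q') ?_ ?_ ?_ ?_ ?_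
  all_goals intro x hx; simp only [mem_filter, mem_range] at hx ⊢
  all_goals try omega
  rw [show x + q' - Q + (q - q') = x + q - Q by omega]

lemma normSq_sum {ι : Type*} (s : Finset ι) (w : ι → ℂ) :
    ((‖∑ i ∈ s, w i‖ ^ 2 : ℝ) : ℂ) = ∑ i ∈ s, ∑ j ∈ s, w i * (starRingEnd ℂ) (w j) := by
  have h := Complex.mul_conj' (∑ i ∈ s, w i)
  push_cast
  rw [← h, map_sum, sum_mul_sum]

/-- The Weyl-van der Corput inequality. -/
lemma weyl_vanDerCorput (z : ℕ → ℂ) (hz : ∀ n, ‖z n‖ ≤ 1) (N Q : ℕ) (hQ : 0 < Q) (hQN : Q ≤ N)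
    (R : ℝ) (hR0 : 0 ≤ R) (hR : ∀ r, 1 ≤ r → r < Q →
      ‖∑ n ∈ range (N - r), z (n + r) * (starRingEnd ℂ) (z n)‖ ≤ R) :
    ‖∑ n ∈ range N, z n‖ ^ 2 ≤ 2 * (N : ℝ) ^ 2 / Q + 2 * N * R := by
  set w : ℕ → ℕ → ℂ := fun m q => if Q ≤ m + q ∧ m + q < Q + N then z (m + q - Q) else 0 with hw
  have h1 : (Q : ℂ) * ∑ n ∈ range N, z n = ∑ m ∈ range (N + Q), ∑ q ∈ range Q, w m q := by
    rw [sum_comm, sum_congr rfl (fun q hq => sum_range_shift z N Q q (mem_range.1 hq))]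
    simp
  have h2 : ‖∑ m ∈ range (N + Q), ∑ q ∈ range Q, w m q‖ ^ 2 ≤
      (N + Q : ℝ) * ∑ m ∈ range (N + Q), ‖∑ q ∈ range Q, w m q‖ ^ 2 := by
    have h3 := sq_sum_le_card_mul_sum_sq (s := range (N + Q))
      (f := fun m => ‖∑ q ∈ range Q, w m q‖)
    rw [card_range] at h3
    push_cast at h3
    refine le_trans ?_ h3
    gcongr
    exact norm_sum_le _ _
  have h4 : ∑ m ∈ range (N + Q), ‖∑ q ∈ range Q, w m q‖ ^ 2 ≤ (Q : ℝ) * N + (Q : ℝ) ^ 2 * R := by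
    have h5 : ((∑ m ∈ range (N + Q), ‖∑ q ∈ range Q, w m q‖ ^ 2 : ℝ) : ℂ) =
        ∑ q ∈ range Q, ∑ q' ∈ range Q, ∑ m ∈ range (N + Q),
          w m q * (starRingEnd ℂ) (w m q') := by
      rw [Complex.ofReal_sum]
      simp only [normSq_sum]
      rw [sum_comm]
      refine sum_congr rfl fun q _ => ?_
      rw [sum_comm]
    have h6 : ∀ q ∈ range Q, ∀ q' ∈ range Q, ‖∑ m ∈ range (N + Q),
        w m q * (starRingEnd ℂ) (w m q')‖ ≤ (if q = q' then (N : ℝ) else 0) + R := by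
      intro q hq q' hq'
      rw [mem_range] at hq hq'
      rcases lt_trichotomy q q' with h | h | h
      · rw [if_neg h.ne, zero_add]
        have h7 := hR (q' - q) (by omega) (by omega)
        rw [← sum_range_shift_mul z N Q q' q h hq', ← RCLike.norm_conj, map_sum] at h7
        refine le_trans (le_of_eq ?_) h7
        congr 1
        refine sum_congr rfl fun m _ => ?_
        rw [map_mul, RCLike.conj_conj, mul_comm]
      · subst h
        rw [if_pos rfl]
        have h8 : ∀ m ∈ range (N + Q), ‖w m q * (starRingEnd ℂ) (w m q)‖ ≤
            if Q ≤ m + q ∧ m + q < Q + N then (1 : ℝ) else 0 := by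
          intro m _
          rw [norm_mul, RCLike.norm_conj]
          simp only [hw]
          split_ifs
          · have := hz (m + q - Q)
            have := norm_nonneg (z (m + q - Q))
            nlinarith
          · simp
        refine (norm_sum_le_of_le _ h8).trans ?_
        have h9 := sum_range_shift (fun _ => 1) N Q q hq
        have h10 : ∑ m ∈ range (N + Q), (if Q ≤ m + q ∧ m + q < Q + N then (1 : ℝ) else 0) = N := by
          rw [← sum_filter] at h9 ⊢
          simpa using h9
        rw [h10]
        linarith
      · rw [if_neg h.ne', zero_add]
        have h7 := hR (q - q') (by omega) (by omega)
        rwa [← sum_range_shift_mul z N Q q q' h hq] at h7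
    have h11 : (∑ m ∈ range (N + Q), ‖∑ q ∈ range Q, w m q‖ ^ 2) ≤
        ∑ q ∈ range Q, ∑ q' ∈ range Q, ((if q = q' then (N : ℝ) else 0) + R) := by
      rw [← Real.norm_of_nonneg (sum_nonneg fun m _ => sq_nonneg ‖∑ q ∈ range Q, w m q‖),
        ← Complex.norm_real, h5]
      exact norm_sum_le_of_le _ fun q hq => norm_sum_le_of_le _ fun q' hq' => h6 q hq q' hq'
    refine h11.trans (le_of_eq ?_)
    have h12 : ∀ q ∈ range Q, ∑ q' ∈ range Q, ((if q = q' then (N : ℝ) else 0) + R) =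
        N + Q * R := fun q hq => by
      rw [sum_add_distrib, sum_ite_eq, if_pos hq, sum_const, card_range, nsmul_eq_mul]
    rw [sum_congr rfl h12, sum_const, card_range, nsmul_eq_mul]
    ring
  have hQ0 : (0 : ℝ) < Q := by exact_mod_cast hQ
  have hQN' : (Q : ℝ) ≤ N := by exact_mod_cast hQN
  have h12 : (Q : ℝ) ^ 2 * ‖∑ n ∈ range N, z n‖ ^ 2 ≤ 2 * N * ((Q : ℝ) * N + (Q : ℝ) ^ 2 * R) := by
    have h13 : (Q : ℝ) ^ 2 * ‖∑ n ∈ range N, z n‖ ^ 2 =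
        ‖∑ m ∈ range (N + Q), ∑ q ∈ range Q, w m q‖ ^ 2 := by
      rw [← h1, norm_mul, Complex.norm_natCast, mul_pow]
    rw [h13]
    exact h2.trans (mul_le_mul (by linarith) h4 (sum_nonneg fun _ _ => sq_nonneg _) (by positivity))
  have h14 : 2 * (N : ℝ) ^ 2 / Q + 2 * N * R = 2 * N * ((Q : ℝ) * N + (Q : ℝ) ^ 2 * R) / Q ^ 2 := by
    field_simp
  rw [h14, le_div_iff₀ (by positivity)]
  linarith

lemma fwdDiff_iter_shift_sub (f : ℕ → ℝ) (k q n : ℕ) :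
    (fwdDiff 1)^[k] (fun m => f (m + q) - f m) n =
      ∑ j ∈ range q, (fwdDiff 1)^[k + 1] f (n + j) := by
  have h1 : (fun m => f (m + q) - f m) = (fun m => f (m + q)) + (-1 : ℝ) • f := by
    ext m; simp; ring
  have h2 : ∀ j, (fwdDiff 1)^[k + 1] f (n + j) =
      (fwdDiff 1)^[k] f (n + (j + 1)) - (fwdDiff 1)^[k] f (n + j) := fun j => by
    rw [Function.iterate_succ_apply', fwdDiff, add_assoc]
  rw [sum_congr rfl (fun j _ => h2 j), sum_range_sub (fun j => (fwdDiff 1)^[k] f (n + j)), h1,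
    fwdDiff_iter_add, Pi.add_apply, fwdDiff_iter_const_smul, fwdDiff_iter_comp_add]
  simp [sub_eq_add_neg]

lemma le_rpow_mul_rpow_of_le {x lam u σ r : ℝ} (hx : 1 ≤ x) (hlam : 0 < lam) (hu : 0 < u)
    (hxl : x ≤ lam ^ (-u)) (hr : 0 ≤ r) (hside : 1 - σ ≤ r / u) :
    x ≤ x ^ σ * lam ^ (-r) := by
  have hx0 : 0 < x := by linarith
  have h2 : x ^ (1 - σ) ≤ lam ^ (-r) := by
    calc x ^ (1 - σ) ≤ x ^ (r / u) := Real.rpow_le_rpow_of_exponent_le hx hside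
      _ ≤ (lam ^ (-u)) ^ (r / u) := Real.rpow_le_rpow hx0.le hxl (by positivity)
      _ = lam ^ (-r) := by
        rw [← Real.rpow_mul hlam.le]; congr 1; field_simp
  calc x = x ^ σ * x ^ (1 - σ) := by rw [← Real.rpow_add hx0]; simp
    _ ≤ _ := mul_le_mul_of_nonneg_left h2 (by positivity)

set_option maxHeartbeats 1000000 in
lemma DifferenceTest.succ {k : ℕ} {p σ r : ℝ} (h : DifferenceTest k p σ r) (hp : 0 < p)
    (hσ : 0 ≤ σ) (hr : 0 ≤ r) (hside : 1 - (1 + σ) / 2 ≤ r / 2 / (p / (1 + p))) :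
    DifferenceTest (k + 1) (p / (1 + p) / 2) ((1 + σ) / 2) (r / 2) := by
  intro C
  obtain ⟨B, hB, hT⟩ := h C
  refine ⟨4 + 2 * B, by positivity, fun f N lam hlam hlam1 hf => ?_⟩
  rcases Nat.eq_zero_or_pos N with rfl | hN
  · simp; positivity
  have hN0 : (0 : ℝ) < N := by exact_mod_cast hN
  have hN1 : (1 : ℝ) ≤ N := by exact_mod_cast hN
  set u := p / (1 + p) with hu
  have hu0 : 0 < u := by positivity
  have hu1 : 1 - u = 1 / (1 + p) := by rw [hu]; field_simp; ring
  have hup : (1 - u) * p = u := by rw [hu1, hu]; ring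
  have hu2 : 0 < 1 - u := by rw [hu1]; positivity
  have hx1 : 1 ≤ lam ^ (-u) := Real.one_le_rpow_of_pos_of_le_one_of_nonpos hlam hlam1 (by linarith)
  set Q := ⌊lam ^ (-u)⌋₊ with hQ
  have hQ1 : 1 ≤ Q := Nat.le_floor (by simpa using hx1)
  have hQle : (Q : ℝ) ≤ lam ^ (-u) := Nat.floor_le (by positivity)
  have hQge : lam ^ (-u) ≤ 2 * Q := by
    have h1 := Nat.lt_floor_add_one (lam ^ (-u))
    have h2 : (1 : ℝ) ≤ Q := by exact_mod_cast hQ1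
    rw [← hQ] at h1
    linarith
  by_cases hQN : Q ≤ N
  · have hR := weyl_vanDerCorput (fun n => eC (f n)) (fun n => (norm_eC _).le) N Q hQ1 hQN
      (B * (N * lam ^ u + (N : ℝ) ^ σ * lam ^ (-r))) (by positivity) (fun q hq1 hqQ => by
        simp only [eC_mul_conj]
        have hq0 : (1 : ℝ) ≤ q := by exact_mod_cast hq1
        have hqlam : (q : ℝ) * lam ≤ lam ^ (1 - u) := by
          have h1 : (q : ℝ) ≤ lam ^ (-u) := le_trans (by exact_mod_cast hqQ.le) hQle
          calc (q : ℝ) * lam ≤ lam ^ (-u) * lam := by gcongr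
            _ = lam ^ (1 - u) := by
              rw [← Real.rpow_add_one hlam.ne']; congr 1; ring
        have h1 := hT (fun n => f (n + q) - f n) (N - q) (q * lam) (by positivity)
          (hqlam.trans (Real.rpow_le_one hlam.le hlam1 hu2.le)) (fun n hn => by
            rw [fwdDiff_iter_shift_sub]
            constructor
            · have h2 := card_nsmul_le_sum (range q)
                (fun j => (fwdDiff 1)^[k + 1] f (n + j)) lam
                (fun j hj => (hf (n + j) (by have := mem_range.1 hj; omega)).1)
              simpa using h2
            · have h2 := sum_le_card_nsmul (range q)
                (fun j => (fwdDiff 1)^[k + 1] f (n + j)) (C * lam)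
                (fun j hj => (hf (n + j) (by have := mem_range.1 hj; omega)).2)
              rw [card_range, nsmul_eq_mul] at h2
              linarith)
        refine h1.trans ?_
        have hNq : ((N - q : ℕ) : ℝ) ≤ N := by exact_mod_cast Nat.sub_le N q
        have h3 : ((q : ℝ) * lam) ^ p ≤ lam ^ u := by
          calc ((q : ℝ) * lam) ^ p ≤ (lam ^ (1 - u)) ^ p := by gcongr
            _ = lam ^ u := by rw [← Real.rpow_mul hlam.le, hup]
        have h4 : ((q : ℝ) * lam) ^ (-r) ≤ lam ^ (-r) :=
          Real.rpow_le_rpow_of_nonpos hlam (by nlinarith) (by linarith)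
        gcongr)
    have hsq : ‖∑ n ∈ range N, eC (f n)‖ ^ 2 ≤
        ((4 + 2 * B) * (N * lam ^ (u / 2) + (N : ℝ) ^ ((1 + σ) / 2) * lam ^ (-(r / 2)))) ^ 2 := by
      set x := lam ^ (u / 2) with hx
      set y := (N : ℝ) ^ ((1 + σ) / 2) * lam ^ (-(r / 2)) with hy
      have hx2 : lam ^ u = x ^ 2 := by
        rw [hx, ← Real.rpow_natCast, ← Real.rpow_mul hlam.le]; congr 1; push_cast; ring
      have hy2 : N * ((N : ℝ) ^ σ * lam ^ (-r)) = y ^ 2 := by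
        rw [hy, mul_pow, ← Real.rpow_natCast, ← Real.rpow_natCast, ← Real.rpow_mul hlam.le,
          ← Real.rpow_mul hN0.le, ← mul_assoc, ← Real.rpow_one_add' hN0.le (by linarith)]
        congr 2 <;> push_cast <;> ring
      have hx0 : 0 < x := by positivity
      have hy0 : 0 < y := by positivity
      have hQ0 : (0 : ℝ) < Q := by exact_mod_cast hQ1
      have h5 : 2 * (N : ℝ) ^ 2 / Q ≤ 4 * N ^ 2 * x ^ 2 := by
        rw [div_le_iff₀ hQ0, ← hx2]
        have h6 : 1 ≤ lam ^ u * (2 * Q) := by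
          calc (1 : ℝ) = lam ^ u * lam ^ (-u) := by rw [← Real.rpow_add hlam]; simp
            _ ≤ lam ^ u * (2 * Q) := by gcongr
        nlinarith [sq_nonneg (N : ℝ)]
      refine hR.trans ?_
      rw [hx2]
      have h7 : 2 * (N : ℝ) * (B * (N * x ^ 2 + (N : ℝ) ^ σ * lam ^ (-r))) =
          2 * B * (N ^ 2 * x ^ 2) + 2 * B * y ^ 2 := by rw [← hy2]; ring
      rw [h7, mul_pow (4 + 2 * B)]
      have h8 : (N : ℝ) ^ 2 * x ^ 2 + y ^ 2 ≤ (N * x + y) ^ 2 := by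
        have : 0 ≤ N * x * y := by positivity
        nlinarith
      have h9 : 4 + 2 * B ≤ (4 + 2 * B) ^ 2 := by nlinarith
      calc 2 * (N : ℝ) ^ 2 / Q + (2 * B * (N ^ 2 * x ^ 2) + 2 * B * y ^ 2)
          ≤ (4 + 2 * B) * (N ^ 2 * x ^ 2 + y ^ 2) := by nlinarith [sq_nonneg y]
        _ ≤ (4 + 2 * B) ^ 2 * (N * x + y) ^ 2 := by gcongr
    exact abs_le_of_sq_le_sq' hsq (by positivity) |>.2
  · have hNlt : (N : ℝ) ≤ lam ^ (-u) := le_trans (by exact_mod_cast (not_le.1 hQN).le) hQle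
    have h1 := le_rpow_mul_rpow_of_le hN1 hlam hu0 hNlt (by linarith) hside
    have h2 := norm_sum_eC_le (range N) f
    rw [card_range] at h2
    have h3 : 0 ≤ (N : ℝ) * lam ^ (u / 2) := by positivity
    have h4 : 0 ≤ (N : ℝ) ^ ((1 + σ) / 2) * lam ^ (-(r / 2)) := by positivity
    calc ‖∑ n ∈ range N, eC (f n)‖ ≤ N := h2
      _ ≤ 1 * (N * lam ^ (u / 2) + (N : ℝ) ^ ((1 + σ) / 2) * lam ^ (-(r / 2))) := by linarith
      _ ≤ _ := mul_le_mul_of_nonneg_right (by linarith) (by linarith)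

lemma differenceTest_three : DifferenceTest 3 (1 / 6) (1 / 2) (1 / 4) := by
  convert differenceTest_two.succ ?_ ?_ ?_ ?_ using 1 <;> norm_num

lemma differenceTest_four : DifferenceTest 4 (1 / 14) (3 / 4) (1 / 8) := by
  convert differenceTest_three.succ ?_ ?_ ?_ ?_ using 1 <;> norm_num

lemma exists_fwdDiff_iter_eq (k : ℕ) : ∀ F : ℕ → ℝ → ℝ,
    (∀ i x, 0 < x → HasDerivAt (F i) (F (i + 1) x) x) → ∀ x : ℝ, 0 < x →
    ∃ ξ ∈ Set.Icc x (x + k), (fwdDiff 1)^[k] (F 0) x = F k ξ := by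
  induction k with
  | zero => intro F _ x _; exact ⟨x, by simp, rfl⟩
  | succ k ih =>
    intro F hF x hx
    obtain ⟨ξ, hξ, h⟩ := ih (fun i => fwdDiff 1 (F i)) (fun i y hy =>
      HasDerivAt.sub ((hF i (y + 1) (by linarith)).comp_add_const y 1) (hF i y hy)) x hx
    have hξ0 : 0 < ξ := hx.trans_le hξ.1
    obtain ⟨η, hη, h2⟩ := exists_hasDerivAt_eq_slope (F k) (F (k + 1)) (lt_add_one ξ)
      (fun y hy => (hF k y (hξ0.trans_le hy.1)).continuousAt.continuousWithinAt)
      (fun y hy => hF k y (hξ0.trans hy.1))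
    refine ⟨η, ⟨hξ.1.trans hη.1.le, ?_⟩, ?_⟩
    · push_cast; linarith [hη.2, hξ.2]
    · rw [Function.iterate_succ_apply, h, h2, fwdDiff]
      simp

lemma exists_fwdDiff_iter_rpow_eq (k : ℕ) (β c x : ℝ) (hx : 0 < x) :
    ∃ ξ ∈ Set.Icc x (x + k), (fwdDiff 1)^[k] (fun y : ℝ => β * y ^ c) x =
      β * (∏ j ∈ range k, (c - j)) * ξ ^ (c - k) := by
  have h := exists_fwdDiff_iter_eq k
    (fun i y => β * (∏ j ∈ range i, (c - j)) * y ^ (c - i)) (fun i y hy => by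
      have h1 := (Real.hasDerivAt_rpow_const (x := y) (p := c - i) (Or.inl hy.ne')).const_mul
        (β * (∏ j ∈ range i, (c - j)))
      refine h1.congr_deriv ?_
      rw [prod_range_succ]
      push_cast
      rw [show c - (i + 1) = c - i - 1 by ring]
      ring) x hx
  simpa using h

lemma fwdDiff_iter_natCast (g : ℝ → ℝ) (k a n : ℕ) :
    (fwdDiff 1)^[k] (fun m : ℕ => g (a + m)) n = (fwdDiff 1)^[k] g (a + n) := by
  induction k generalizing n with
  | zero => rfl
  | succ k ih =>
    rw [Function.iterate_succ_apply', Function.iterate_succ_apply', fwdDiff, fwdDiff, ih, ih]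
    push_cast
    rw [add_assoc]

lemma rpow_mem_of_mem_Icc {t W e : ℝ} (h1 : 1 ≤ t) (h2 : t ≤ W) :
    (W ^ |e|)⁻¹ ≤ t ^ e ∧ t ^ e ≤ W ^ |e| := by
  have ht : 0 < t := by linarith
  have h3 : t ^ |e| ≤ W ^ |e| := by gcongr
  have h4 : t ^ e ≤ t ^ |e| := Real.rpow_le_rpow_of_exponent_le h1 (le_abs_self e)
  have h5 : t ^ (-|e|) ≤ t ^ e := Real.rpow_le_rpow_of_exponent_le h1 (neg_abs_le e)
  rw [Real.rpow_neg ht.le] at h5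
  refine ⟨le_trans ?_ h5, h4.trans h3⟩
  gcongr

lemma card_Ioc_floor_le {K : ℝ} (hK : 1 ≤ K) : (#(Ioc ⌊K⌋₊ ⌊2 * K⌋₊) : ℝ) ≤ 2 * K := by
  rw [Nat.card_Ioc]
  have h1 : ((⌊2 * K⌋₊ - ⌊K⌋₊ : ℕ) : ℝ) ≤ ⌊2 * K⌋₊ := by exact_mod_cast Nat.sub_le _ _
  exact h1.trans (Nat.floor_le (by linarith))

/-- Difference tests applied to `β k^c` on a dyadic interval. -/
lemma exists_norm_sum_monomial_le (c : ℝ) (k : ℕ) (p σ r : ℝ) (hp : 0 ≤ p) (hσ : 0 ≤ σ)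
    (hσ1 : σ ≤ 1) (hG : ∏ j ∈ range k, (c - j) ≠ 0) (hT : DifferenceTest k p σ r) :
    ∃ B > 0, ∀ β K : ℝ, β ≠ 0 → 1 ≤ K →
      ‖∑ n ∈ Ioc ⌊K⌋₊ ⌊2 * K⌋₊, eC (β * (n : ℝ) ^ c)‖ ≤
        B * (K * (|β| * K ^ (c - k)) ^ p + K ^ σ * (|β| * K ^ (c - k)) ^ (-r)) := by
  set G := ∏ j ∈ range k, (c - j) with hGd
  set W : ℝ := (2 + k : ℝ) ^ |c - k| with hW
  have hW0 : 0 < W := by positivity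
  have hG0 : 0 < |G| := abs_pos.2 hG
  set v : ℝ := |G| / W with hv
  have hv0 : 0 < v := by positivity
  obtain ⟨B, hB, hBT⟩ := hT (W ^ 2)
  refine ⟨B * (2 * v ^ p + 2 * v ^ (-r)) + 2 * v ^ p, by positivity, fun β K hβ hK => ?_⟩
  have hK0 : 0 < K := by linarith
  have hβ0 : 0 < |β| := abs_pos.2 hβ
  obtain ⟨L, hL⟩ : ∃ L, L = |β| * K ^ (c - k) := ⟨_, rfl⟩
  have hL0 : 0 < L := by rw [hL]; positivity
  rw [← hL]
  have hcard := card_Ioc_floor_le hK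
  by_cases hlam : v * L ≤ 1
  · set N := ⌊2 * K⌋₊ - ⌊K⌋₊ with hN
    have hNK : (N : ℝ) ≤ 2 * K := by rwa [Nat.card_Ioc] at hcard
    set f : ℕ → ℝ := fun m => β * (((⌊K⌋₊ + 1 : ℕ) : ℝ) + m) ^ c with hf
    have hsum : ∑ n ∈ Ioc ⌊K⌋₊ ⌊2 * K⌋₊, eC (β * (n : ℝ) ^ c) = ∑ n ∈ range N, eC (f n) := by
      rw [← Finset.Ico_add_one_add_one_eq_Ioc, sum_Ico_eq_sum_range]
      rw [show ⌊2 * K⌋₊ + 1 - (⌊K⌋₊ + 1) = N by omega]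
      refine sum_congr rfl fun n _ => ?_
      simp only [hf]
      push_cast
      rfl
    have hd : ∀ n < N, ∃ t : ℝ, v * L ≤ |G| * L * t ∧ |G| * L * t ≤ W ^ 2 * (v * L) ∧
        |β * G| * (K ^ (c - k) * t) = |G| * L * t ∧
        (fwdDiff 1)^[k] f n = β * G * (K ^ (c - k) * t) := by
      intro n hn
      have hpos : (0 : ℝ) < ((⌊K⌋₊ + 1 : ℕ) : ℝ) + n := by positivity
      obtain ⟨ξ, hξ, h1⟩ := exists_fwdDiff_iter_rpow_eq k β c _ hpos
      have h2 := fwdDiff_iter_natCast (fun y => β * y ^ c) k (⌊K⌋₊ + 1) n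
      have hKξ : K ≤ ξ := by
        refine le_trans ?_ hξ.1
        have := (Nat.lt_floor_add_one K).le
        push_cast
        have hn0 : (0 : ℝ) ≤ n := by positivity
        linarith
      have hξK : ξ ≤ (2 + k) * K := by
        refine hξ.2.trans ?_
        have h3 : ((⌊K⌋₊ + 1 : ℕ) : ℝ) + n ≤ ⌊2 * K⌋₊ := by
          have : ⌊K⌋₊ + 1 + n ≤ ⌊2 * K⌋₊ := by omega
          exact_mod_cast this
        have h4 := Nat.floor_le (by linarith : 0 ≤ 2 * K)
        have h5 : (0 : ℝ) ≤ k := by positivity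
        nlinarith
      have ht := rpow_mem_of_mem_Icc (t := ξ / K) (W := 2 + k) (e := c - k)
        ((one_le_div hK0).2 hKξ) ((div_le_iff₀ hK0).2 hξK)
      rw [← hW] at ht
      refine ⟨(ξ / K) ^ (c - k), ?_, ?_, ?_, ?_⟩
      · calc v * L = |G| * L * W⁻¹ := by rw [hv]; field_simp
          _ ≤ _ := by gcongr; exact ht.1
      · calc |G| * L * (ξ / K) ^ (c - k) ≤ |G| * L * W := by gcongr; exact ht.2
          _ = _ := by rw [hv]; field_simp
      · rw [abs_mul, hL]; ring
      · rw [h2, h1, ← Real.mul_rpow hK0.le (div_nonneg (hK0.le.trans hKξ) hK0.le)]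
        congr 2
        field_simp
    have hmain : ‖∑ n ∈ range N, eC (f n)‖ ≤
        B * (N * (v * L) ^ p + (N : ℝ) ^ σ * (v * L) ^ (-r)) := by
      rcases lt_or_gt_of_ne (mul_ne_zero hβ hG) with hneg | hpos
      · rw [← norm_sum_eC_neg]
        apply hBT (fun n => -f n) N (v * L) (by positivity) hlam
        intro n hn
        obtain ⟨t, h1, h2, h3, h4⟩ := hd n hn
        have h5 : (fwdDiff 1)^[k] (fun n => -f n) n = -(fwdDiff 1)^[k] f n := by
          have := congrFun (fwdDiff_iter_const_smul 1 (-1 : ℝ) f k) n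
          rw [show (fun n => -f n) = -f from rfl]
          simpa using this
        rw [abs_of_neg hneg] at h3
        rw [h5, h4]
        constructor <;> linarith
      · apply hBT f N (v * L) (by positivity) hlam
        intro n hn
        obtain ⟨t, h1, h2, h3, h4⟩ := hd n hn
        rw [abs_of_pos hpos] at h3
        rw [h4]
        constructor <;> linarith
    rw [hsum]
    refine hmain.trans ?_
    have h1 : (N : ℝ) ^ σ ≤ 2 * K ^ σ := by
      calc (N : ℝ) ^ σ ≤ (2 * K) ^ σ := by gcongr
        _ = 2 ^ σ * K ^ σ := Real.mul_rpow (by norm_num) hK0.le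
        _ ≤ 2 ^ (1 : ℝ) * K ^ σ := by gcongr; norm_num
        _ = 2 * K ^ σ := by rw [Real.rpow_one]
    rw [Real.mul_rpow hv0.le hL0.le, Real.mul_rpow hv0.le hL0.le]
    calc B * (N * (v ^ p * L ^ p) + (N : ℝ) ^ σ * (v ^ (-r) * L ^ (-r)))
        ≤ B * (2 * K * (v ^ p * L ^ p) + 2 * K ^ σ * (v ^ (-r) * L ^ (-r))) := by gcongr
      _ = B * (2 * v ^ p) * (K * L ^ p) + B * (2 * v ^ (-r)) * (K ^ σ * L ^ (-r)) := by ring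
      _ ≤ (B * (2 * v ^ p + 2 * v ^ (-r)) + 2 * v ^ p) * (K * L ^ p) +
          (B * (2 * v ^ p + 2 * v ^ (-r)) + 2 * v ^ p) * (K ^ σ * L ^ (-r)) := by
        have e1 : 0 < v ^ p := by positivity
        have e2 : 0 < v ^ (-r) := by positivity
        have e4 := mul_pos hB e1
        have e5 := mul_pos hB e2
        gcongr <;> linarith
      _ = _ := by ring
  · rw [not_le] at hlam
    have h1 : 1 ≤ v ^ p * L ^ p := by
      rw [← Real.mul_rpow hv0.le hL0.le]
      exact Real.one_le_rpow hlam.le hp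
    have h2 := norm_sum_eC_le (Ioc ⌊K⌋₊ ⌊2 * K⌋₊) (fun n => β * (n : ℝ) ^ c)
    have e1 : 0 ≤ B * (2 * v ^ p + 2 * v ^ (-r)) := by positivity
    have e2 : 0 ≤ K ^ σ * L ^ (-r) := by positivity
    have e3 : 0 ≤ K * L ^ p := by positivity
    calc ‖∑ n ∈ Ioc ⌊K⌋₊ ⌊2 * K⌋₊, eC (β * (n : ℝ) ^ c)‖ ≤ 2 * K * 1 := by linarith
      _ ≤ 2 * K * (v ^ p * L ^ p) := by gcongr
      _ = 2 * v ^ p * (K * L ^ p) := by ring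
      _ ≤ (B * (2 * v ^ p + 2 * v ^ (-r)) + 2 * v ^ p) * (K * L ^ p) := by gcongr; linarith
      _ ≤ _ := by gcongr; linarith

lemma exp_form_of_pos {β K D c : ℝ} {d κ : ℝ} (hD : |β| * K ^ c = D) (hd : D = exp d)
    (hκ : K = exp κ) (k : ℕ) (p : ℝ) :
    (|β| * K ^ (c - k)) ^ p = exp ((d - k * κ) * p) := by
  have hK : 0 < K := hκ ▸ Real.exp_pos κ
  have h : |β| * K ^ (c - k) = exp (d - k * κ) := by
    rw [Real.rpow_sub hK, ← mul_div_assoc, hD, hd, Real.exp_sub, hκ, ← Real.exp_mul, mul_comm κ]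
  rw [h, ← Real.exp_mul]

lemma add_exp_le_two_mul_exp {B a b e : ℝ} (hB : 0 < B) (ha : a ≤ e) (hb : b ≤ e) :
    B * (exp a + exp b) ≤ 2 * B * exp e := by
  have h1 := Real.exp_le_exp.2 ha
  have h2 := Real.exp_le_exp.2 hb
  nlinarith

/-- Power saving for `∑ e(β k^c)` as soon as `|β| K^c` lies in a suitable range. -/
lemma exists_norm_sum_monomial_le_saving (c : ℝ) (hc1 : 1 < c) (hc2 : c < 3) (hc3 : c ≠ 2) :
    ∃ B > 0, ∀ s X β K : ℝ, 0 ≤ s → s ≤ 1 / 30 → 1 ≤ X → X ^ (1 / 2 : ℝ) ≤ K →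
      X ^ (1 / 10 : ℝ) ≤ |β| * K ^ c → |β| * K ^ c ≤ K ^ 4 * X ^ (-(14 * s)) →
      ‖∑ n ∈ Ioc ⌊K⌋₊ ⌊2 * K⌋₊, eC (β * (n : ℝ) ^ c)‖ ≤ B * (K * X ^ (-s)) := by
  have hc0 : c ≠ 0 := by linarith
  have hc4 : c - 1 ≠ 0 := by linarith
  have hc5 : c - 2 ≠ 0 := sub_ne_zero.2 hc3
  have hc6 : c - 3 ≠ 0 := by linarith
  obtain ⟨B2, hB2, h2⟩ := exists_norm_sum_monomial_le c 2 (1 / 2) 0 (1 / 2) (by norm_num)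
    (by norm_num) (by norm_num) (by simp [prod_range_succ, *]) differenceTest_two
  obtain ⟨B3, hB3, h3⟩ := exists_norm_sum_monomial_le c 3 (1 / 6) (1 / 2) (1 / 4) (by norm_num)
    (by norm_num) (by norm_num) (by simp [prod_range_succ, *]) differenceTest_three
  obtain ⟨B4, hB4, h4⟩ := exists_norm_sum_monomial_le c 4 (1 / 14) (3 / 4) (1 / 8) (by norm_num)
    (by norm_num) (by norm_num) (by simp [prod_range_succ, *]) differenceTest_four
  refine ⟨2 * B2 + 2 * B3 + 2 * B4, by positivity, fun s X β K hs hs1 hX hK hlow hup => ?_⟩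
  have hX0 : 0 < X := by linarith
  have hK1 : 1 ≤ K := le_trans (Real.one_le_rpow hX (by norm_num)) hK
  have hK0 : 0 < K := by linarith
  have hβ : β ≠ 0 := by
    rintro rfl
    have : 0 < X ^ (1 / 10 : ℝ) := by positivity
    simp at hlow
    linarith
  obtain ⟨D, hD⟩ : ∃ D, |β| * K ^ c = D := ⟨_, rfl⟩
  have hD0 : 0 < D := by rw [← hD]; have := abs_pos.2 hβ; positivity
  obtain ⟨d, hd⟩ : ∃ d, D = exp d := ⟨log D, (Real.exp_log hD0).symm⟩
  obtain ⟨κ, hκ⟩ : ∃ κ, K = exp κ := ⟨log K, (Real.exp_log hK0).symm⟩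
  obtain ⟨x, hx⟩ : ∃ x, X = exp x := ⟨log X, (Real.exp_log hX0).symm⟩
  have hx0 : 0 ≤ x := by rw [hx] at hX; exact Real.one_le_exp_iff.1 hX
  have hsx : x * s ≤ x * (1 / 30) := by gcongr
  have hsx0 : 0 ≤ x * s := by positivity
  have hKx : x * (1 / 2) ≤ κ := by
    rw [hx, hκ, ← Real.exp_mul] at hK; exact Real.exp_le_exp.1 hK
  have hlow' : x * (1 / 10) ≤ d := by
    rw [hD, hd, hx, ← Real.exp_mul] at hlow; exact Real.exp_le_exp.1 hlow
  have hup' : d ≤ 4 * κ - 14 * (x * s) := by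
    rw [hD, hd, hx, hκ, ← Real.exp_mul, ← Real.exp_nat_mul, ← Real.exp_add] at hup
    have := Real.exp_le_exp.1 hup
    push_cast at this
    linarith
  have hT2 := h2 β K hβ hK1
  have hT3 := h3 β K hβ hK1
  have hT4 := h4 β K hβ hK1
  simp only [exp_form_of_pos hD hd hκ] at hT2 hT3 hT4
  have hgoal : K * X ^ (-s) = exp (κ - x * s) := by
    rw [hκ, hx, ← Real.exp_mul, ← Real.exp_add]; congr 1; ring
  rw [hgoal]
  have hKp : ∀ q : ℝ, K ^ q = exp (κ * q) := fun q => by rw [hκ, ← Real.exp_mul]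
  rw [hKp, hκ, ← Real.exp_add, ← Real.exp_add] at hT2 hT3 hT4
  rw [← hκ] at hT2 hT3 hT4
  push_cast at hT2 hT3 hT4
  have he := Real.exp_pos (κ - x * s)
  rcases le_or_gt d (2 * κ - 2 * (x * s)) with hd2 | hd2
  · refine hT2.trans ((add_exp_le_two_mul_exp (e := κ - x * s) hB2 (by linarith)
      (by linarith)).trans ?_)
    gcongr; linarith
  · rcases le_or_gt d (3 * κ - 6 * (x * s)) with hd3 | hd3
    · refine hT3.trans ((add_exp_le_two_mul_exp (e := κ - x * s) hB3 (by linarith)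
        (by linarith)).trans ?_)
      gcongr; linarith
    · refine hT4.trans ((add_exp_le_two_mul_exp (e := κ - x * s) hB4 (by linarith)
        (by linarith)).trans ?_)
      gcongr; linarith

lemma sum_norm_sq_le {ι : Type*} (J : Finset ι) (S : Finset ℕ) (w : ι → ℂ) (β : ι → ℝ) (c : ℝ) :
    ∑ k ∈ S, ‖∑ j ∈ J, w j * eC (β j * (k : ℝ) ^ c)‖ ^ 2 ≤
      ∑ i ∈ J, ∑ j ∈ J, ‖w i‖ * ‖w j‖ * ‖∑ k ∈ S, eC ((β i - β j) * (k : ℝ) ^ c)‖ := by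
  have h : ((∑ k ∈ S, ‖∑ j ∈ J, w j * eC (β j * (k : ℝ) ^ c)‖ ^ 2 : ℝ) : ℂ) =
      ∑ i ∈ J, ∑ j ∈ J, w i * (starRingEnd ℂ) (w j) *
        ∑ k ∈ S, eC ((β i - β j) * (k : ℝ) ^ c) := by
    rw [Complex.ofReal_sum]
    simp only [normSq_sum]
    rw [sum_comm]
    refine sum_congr rfl fun i _ => ?_
    rw [sum_comm]
    refine sum_congr rfl fun j _ => ?_
    rw [mul_sum]
    refine sum_congr rfl fun k _ => ?_
    rw [map_mul, mul_mul_mul_comm, eC_mul_conj, sub_mul]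
  rw [← Real.norm_of_nonneg (sum_nonneg fun k _ => sq_nonneg _), ← Complex.norm_real, h]
  refine norm_sum_le_of_le _ fun i _ => norm_sum_le_of_le _ fun j _ => ?_
  rw [norm_mul, norm_mul, RCLike.norm_conj]

lemma bilinear_sq_le {ι : Type*} (J : Finset ι) (S : Finset ℕ) (w : ι → ℂ) (b : ℕ → ℂ)
    (β : ι → ℝ) (c G : ℝ) (hb : ∀ k ∈ S, ‖b k‖ ≤ G) :
    ‖∑ k ∈ S, b k * ∑ j ∈ J, w j * eC (β j * (k : ℝ) ^ c)‖ ^ 2 ≤ (#S * G ^ 2) *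
      ∑ i ∈ J, ∑ j ∈ J, ‖w i‖ * ‖w j‖ * ‖∑ k ∈ S, eC ((β i - β j) * (k : ℝ) ^ c)‖ := by
  have h1 : ‖∑ k ∈ S, b k * ∑ j ∈ J, w j * eC (β j * (k : ℝ) ^ c)‖ ≤
      ∑ k ∈ S, ‖b k‖ * ‖∑ j ∈ J, w j * eC (β j * (k : ℝ) ^ c)‖ :=
    norm_sum_le_of_le _ fun k _ => (norm_mul _ _).le
  have h2 := sum_mul_sq_le_sq_mul_sq S (fun k => ‖b k‖)
    (fun k => ‖∑ j ∈ J, w j * eC (β j * (k : ℝ) ^ c)‖)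
  have h3 : ∑ k ∈ S, ‖b k‖ ^ 2 ≤ #S * G ^ 2 := by
    have := sum_le_card_nsmul S (fun k => ‖b k‖ ^ 2) (G ^ 2) fun k hk => by
      have := hb k hk
      gcongr
    simpa using this
  calc _ ≤ (∑ k ∈ S, ‖b k‖ * ‖∑ j ∈ J, w j * eC (β j * (k : ℝ) ^ c)‖) ^ 2 :=
        pow_le_pow_left₀ (norm_nonneg _) h1 2
    _ ≤ _ := h2
    _ ≤ _ := mul_le_mul h3 (sum_norm_sq_le J S w β c) (sum_nonneg fun _ _ => sq_nonneg _)
        (by positivity)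

/-- Well-spaced frequencies are almost orthogonal. -/
lemma exists_bilinear_spaced_le (c : ℝ) (hc1 : 1 < c) (hc2 : c < 3) (hc3 : c ≠ 2) :
    ∃ B > 0, ∀ (J : Finset ℕ) (w b : ℕ → ℂ) (β : ℕ → ℝ) (s X K G₁ G₂ : ℝ),
      0 ≤ s → s ≤ 1 / 30 → 1 ≤ X → X ^ (1 / 2 : ℝ) ≤ K → (#J : ℝ) ≤ X ^ s →
      0 ≤ G₁ → 0 ≤ G₂ →
      (∀ j ∈ J, ‖w j‖ ≤ G₁) → (∀ k ∈ Ioc ⌊K⌋₊ ⌊2 * K⌋₊, ‖b k‖ ≤ G₂) →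
      (∀ i ∈ J, ∀ j ∈ J, i ≠ j → X ^ (1 / 10 : ℝ) ≤ |β i - β j| * K ^ c ∧
        |β i - β j| * K ^ c ≤ K ^ 4 * X ^ (-(14 * s))) →
      ‖∑ k ∈ Ioc ⌊K⌋₊ ⌊2 * K⌋₊, b k * ∑ j ∈ J, w j * eC (β j * (k : ℝ) ^ c)‖ ≤
        B * (G₁ * G₂ * K * √(#J)) := by
  obtain ⟨B, hB, h⟩ := exists_norm_sum_monomial_le_saving c hc1 hc2 hc3
  refine ⟨4 + 2 * B, by positivity,
    fun J w b β s X K G₁ G₂ hs hs1 hX hK hJ hG1 hG2 hw hb hβ => ?_⟩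
  have hX0 : 0 < X := by linarith
  have hK1 : 1 ≤ K := le_trans (Real.one_le_rpow hX (by norm_num)) hK
  have hcard := card_Ioc_floor_le hK1
  have hpair : ∀ i ∈ J, ∀ j ∈ J, ‖w i‖ * ‖w j‖ *
      ‖∑ k ∈ Ioc ⌊K⌋₊ ⌊2 * K⌋₊, eC ((β i - β j) * (k : ℝ) ^ c)‖ ≤
      G₁ ^ 2 * ((if i = j then 2 * K else 0) + B * (K * X ^ (-s))) := by
    intro i hi j hj
    have h1 : ‖∑ k ∈ Ioc ⌊K⌋₊ ⌊2 * K⌋₊, eC ((β i - β j) * (k : ℝ) ^ c)‖ ≤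
        (if i = j then 2 * K else 0) + B * (K * X ^ (-s)) := by
      have h0 : 0 ≤ B * (K * X ^ (-s)) := by positivity
      split_ifs with hij
      · have := norm_sum_eC_le (Ioc ⌊K⌋₊ ⌊2 * K⌋₊) (fun k => (β i - β j) * (k : ℝ) ^ c)
        linarith
      · rw [zero_add]
        exact h s X _ K hs hs1 hX hK (hβ i hi j hj hij).1 (hβ i hi j hj hij).2
    calc _ ≤ G₁ * G₁ * ((if i = j then 2 * K else 0) + B * (K * X ^ (-s))) := by
          gcongr
          · exact hw i hi
          · exact hw j hj
      _ = _ := by ring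
  have hsum : ∑ i ∈ J, ∑ j ∈ J, ‖w i‖ * ‖w j‖ *
      ‖∑ k ∈ Ioc ⌊K⌋₊ ⌊2 * K⌋₊, eC ((β i - β j) * (k : ℝ) ^ c)‖ ≤
      G₁ ^ 2 * ((2 + B) * K * #J) := by
    calc _ ≤ ∑ i ∈ J, ∑ j ∈ J,
          G₁ ^ 2 * ((if i = j then 2 * K else 0) + B * (K * X ^ (-s))) :=
          sum_le_sum fun i hi => sum_le_sum fun j hj => hpair i hi j hj
      _ = ∑ i ∈ J, G₁ ^ 2 * (2 * K + #J * (B * (K * X ^ (-s)))) := by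
          refine sum_congr rfl fun i hi => ?_
          rw [← mul_sum, sum_add_distrib, sum_ite_eq, if_pos hi, sum_const, nsmul_eq_mul]
      _ = G₁ ^ 2 * (2 * K * #J + #J * (#J * X ^ (-s)) * (B * K)) := by
          rw [sum_const, nsmul_eq_mul]; ring
      _ ≤ G₁ ^ 2 * (2 * K * #J + #J * 1 * (B * K)) := by
          have : (#J : ℝ) * X ^ (-s) ≤ 1 := by
            calc (#J : ℝ) * X ^ (-s) ≤ X ^ s * X ^ (-s) := by gcongr
              _ = 1 := by rw [← Real.rpow_add hX0]; simp
          gcongr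
      _ = _ := by ring
  have h2 := bilinear_sq_le J (Ioc ⌊K⌋₊ ⌊2 * K⌋₊) w b β c G₂ hb
  have h3 : ‖∑ k ∈ Ioc ⌊K⌋₊ ⌊2 * K⌋₊, b k * ∑ j ∈ J, w j * eC (β j * (k : ℝ) ^ c)‖ ^ 2 ≤
      ((4 + 2 * B) * (G₁ * G₂ * K * √(#J))) ^ 2 := by
    calc _ ≤ (2 * K * G₂ ^ 2) * (G₁ ^ 2 * ((2 + B) * K * #J)) :=
          h2.trans (mul_le_mul (by gcongr) hsum (by positivity) (by positivity))
      _ = (4 + 2 * B) * (G₁ * G₂ * K * √(#J)) ^ 2 := by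
          rw [mul_pow (G₁ * G₂ * K), Real.sq_sqrt (by positivity)]; ring
      _ ≤ (4 + 2 * B) ^ 2 * (G₁ * G₂ * K * √(#J)) ^ 2 := by gcongr; nlinarith
      _ = _ := by ring
  exact abs_le_of_sq_le_sq' h3 (by positivity) |>.2

lemma one_le_abs_rpow_sub_rpow {c : ℝ} (hc : 1 ≤ c) {a b : ℕ} (hab : a ≠ b) :
    1 ≤ |(a : ℝ) ^ c - (b : ℝ) ^ c| := by
  have key : ∀ a b : ℕ, a < b → 1 ≤ (b : ℝ) ^ c - (a : ℝ) ^ c := by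
    intro a b h
    have h1 : (a : ℝ) + 1 ≤ b := by exact_mod_cast h
    have h2 : (a : ℝ) ^ c + 1 ^ c ≤ ((a : ℝ) + 1) ^ c :=
      Real.add_rpow_le_rpow_add (by positivity) zero_le_one hc
    have h3 : ((a : ℝ) + 1) ^ c ≤ (b : ℝ) ^ c := by gcongr
    rw [Real.one_rpow] at h2
    linarith
  rcases lt_or_gt_of_ne hab with h | h
  · rw [abs_sub_comm]
    exact (key a b h).trans (le_abs_self _)
  · exact (key b a h).trans (le_abs_self _)

lemma le_abs_int_add {α τ : ℝ} (h1 : τ ≤ α) (h2 : α ≤ 1 - τ) (h : ℤ) : τ ≤ |(h : ℝ) + α| := by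
  rcases le_or_gt 0 h with hh | hh
  · have : (0 : ℝ) ≤ h := by exact_mod_cast hh
    exact le_trans (by linarith) (le_abs_self _)
  · have : (h : ℝ) ≤ -1 := by exact_mod_cast (by omega : h ≤ -1)
    exact le_trans (by linarith) (neg_le_abs _)

/-- Near coincidences `(h + α) m^c ≈ (j + α) n^c` with the same `j` have the same ratio. -/
lemma resonance_ratio_eq {c α τ θ M : ℝ} (hc : 1 ≤ c) (hα : τ ≤ α) (hα1 : α ≤ 1 - τ)
    (hθτ : 2 * θ * (2 * M) ^ c < τ) (h h' : ℤ) (m₁ n₁ m₂ n₂ : ℕ)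
    (hn₁ : (n₁ : ℝ) ≤ 2 * M) (hn₂ : (n₂ : ℝ) ≤ 2 * M) (hθ : 0 ≤ θ)
    (h₁ : |((h : ℝ) + α) * (m₁ : ℝ) ^ c - ((h' : ℝ) + α) * (n₁ : ℝ) ^ c| ≤ θ)
    (h₂ : |((h : ℝ) + α) * (m₂ : ℝ) ^ c - ((h' : ℝ) + α) * (n₂ : ℝ) ^ c| ≤ θ) :
    m₁ * n₂ = m₂ * n₁ := by
  by_contra hne
  have h3 := one_le_abs_rpow_sub_rpow hc hne
  push_cast at h3
  rw [Real.mul_rpow (by positivity) (by positivity),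
    Real.mul_rpow (by positivity) (by positivity)] at h3
  have h4 := le_abs_int_add hα hα1 h
  have e : ((h : ℝ) + α) * ((m₁ : ℝ) ^ c * (n₂ : ℝ) ^ c - (m₂ : ℝ) ^ c * (n₁ : ℝ) ^ c) =
      (((h : ℝ) + α) * (m₁ : ℝ) ^ c - ((h' : ℝ) + α) * (n₁ : ℝ) ^ c) * (n₂ : ℝ) ^ c -
      (((h : ℝ) + α) * (m₂ : ℝ) ^ c - ((h' : ℝ) + α) * (n₂ : ℝ) ^ c) * (n₁ : ℝ) ^ c := by ring
  have h5 : |(h : ℝ) + α| * |(m₁ : ℝ) ^ c * (n₂ : ℝ) ^ c - (m₂ : ℝ) ^ c * (n₁ : ℝ) ^ c| ≤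
      θ * (2 * M) ^ c + θ * (2 * M) ^ c := by
    rw [← abs_mul, e]
    refine (abs_sub _ _).trans ?_
    rw [abs_mul, abs_mul, abs_of_nonneg (by positivity : 0 ≤ (n₂ : ℝ) ^ c),
      abs_of_nonneg (by positivity : 0 ≤ (n₁ : ℝ) ^ c)]
    gcongr
  have h6 : |(h : ℝ) + α| * 1 ≤
      |(h : ℝ) + α| * |(m₁ : ℝ) ^ c * (n₂ : ℝ) ^ c - (m₂ : ℝ) ^ c * (n₁ : ℝ) ^ c| := by gcongr
  linarith

/-- Near coincidences with the same ratio have the same `j`. -/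
lemma resonance_int_eq {c α θ : ℝ} (hc : 0 ≤ c) (hθ : 0 < θ) (hθ1 : θ < 1 / 2)
    (h h₁' h₂' : ℤ) (m₁ n₁ m₂ n₂ : ℕ) (hn₁ : 1 ≤ n₁) (hn₂ : 1 ≤ n₂)
    (h₁ : |((h : ℝ) + α) * (m₁ : ℝ) ^ c - ((h₁' : ℝ) + α) * (n₁ : ℝ) ^ c| ≤ θ)
    (h₂ : |((h : ℝ) + α) * (m₂ : ℝ) ^ c - ((h₂' : ℝ) + α) * (n₂ : ℝ) ^ c| ≤ θ)
    (heq : m₁ * n₂ = m₂ * n₁) : h₁' = h₂' := by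
  by_contra hne
  have h3 : (1 : ℝ) ≤ |(h₂' : ℝ) - h₁'| := by
    have : 1 ≤ |h₂' - h₁'| := Int.one_le_abs (by omega)
    exact_mod_cast this
  have h4 : (m₁ : ℝ) ^ c * (n₂ : ℝ) ^ c = (m₂ : ℝ) ^ c * (n₁ : ℝ) ^ c := by
    rw [← Real.mul_rpow (by positivity) (by positivity),
      ← Real.mul_rpow (by positivity) (by positivity)]
    congr 1
    exact_mod_cast heq
  have e : ((h₂' : ℝ) - h₁') * ((n₁ : ℝ) ^ c * (n₂ : ℝ) ^ c) =
      (((h : ℝ) + α) * (m₁ : ℝ) ^ c - ((h₁' : ℝ) + α) * (n₁ : ℝ) ^ c) * (n₂ : ℝ) ^ c -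
      (((h : ℝ) + α) * (m₂ : ℝ) ^ c - ((h₂' : ℝ) + α) * (n₂ : ℝ) ^ c) * (n₁ : ℝ) ^ c := by
    linear_combination (-((h : ℝ) + α)) * h4
  have hx : 1 ≤ (n₁ : ℝ) ^ c := Real.one_le_rpow (by exact_mod_cast hn₁) hc
  have hy : 1 ≤ (n₂ : ℝ) ^ c := Real.one_le_rpow (by exact_mod_cast hn₂) hc
  set x := (n₁ : ℝ) ^ c
  set y := (n₂ : ℝ) ^ c
  have h5 : |(h₂' : ℝ) - h₁'| * (x * y) ≤ θ * y + θ * x := by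
    rw [← abs_of_nonneg (by positivity : 0 ≤ x * y), ← abs_mul, e]
    refine (abs_sub _ _).trans ?_
    rw [abs_mul, abs_mul, abs_of_nonneg (by positivity : 0 ≤ y),
      abs_of_nonneg (by positivity : 0 ≤ x)]
    gcongr
  have h6 : 1 * (x * y) ≤ |(h₂' : ℝ) - h₁'| * (x * y) := by gcongr
  have h7 : y ≤ x * y := by nlinarith
  have h8 : x ≤ x * y := by nlinarith
  nlinarith

lemma resonance_int_le {c α θ M : ℝ} (hc : 0 ≤ c) (hc3 : c ≤ 3) (hα0 : 0 ≤ α) (hα1 : α ≤ 1)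
    (hθ1 : θ ≤ 1) (h h' : ℤ) (m n : ℕ) (hM : 1 ≤ M)
    (hm : (m : ℝ) ≤ 2 * M) (hn : M ≤ (n : ℝ))
    (h₁ : |((h : ℝ) + α) * (m : ℝ) ^ c - ((h' : ℝ) + α) * (n : ℝ) ^ c| ≤ θ) :
    |(h' : ℝ)| ≤ 10 * (1 + |(h : ℝ)|) := by
  have hnc : 1 ≤ (n : ℝ) ^ c := Real.one_le_rpow (hM.trans hn) hc
  have hmc : (m : ℝ) ^ c ≤ 8 * (n : ℝ) ^ c := by
    calc (m : ℝ) ^ c ≤ (2 * n) ^ c := by gcongr; linarith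
      _ = 2 ^ c * (n : ℝ) ^ c := Real.mul_rpow (by norm_num) (by positivity)
      _ ≤ 2 ^ (3 : ℝ) * (n : ℝ) ^ c := by gcongr; norm_num
      _ = _ := by norm_num
  have hm0 : 0 ≤ (m : ℝ) ^ c := by positivity
  have h2 : |(h' : ℝ) + α| * (n : ℝ) ^ c ≤ |(h : ℝ) + α| * (m : ℝ) ^ c + θ := by
    have h3 := abs_sub_abs_le_abs_sub (((h' : ℝ) + α) * (n : ℝ) ^ c) (((h : ℝ) + α) * (m : ℝ) ^ c)
    rw [abs_sub_comm] at h3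
    rw [abs_mul, abs_mul, abs_of_nonneg hm0, abs_of_nonneg (by linarith : 0 ≤ (n : ℝ) ^ c)] at h3
    linarith
  have h4 : |(h' : ℝ) + α| ≤ 8 * |(h : ℝ) + α| + 1 := by
    have h5 : |(h' : ℝ) + α| * (n : ℝ) ^ c ≤ (8 * |(h : ℝ) + α| + 1) * (n : ℝ) ^ c := by
      have h6 : |(h : ℝ) + α| * (m : ℝ) ^ c ≤ |(h : ℝ) + α| * (8 * (n : ℝ) ^ c) := by gcongr
      nlinarith
    exact le_of_mul_le_mul_right h5 (by linarith)
  have h7 : |(h : ℝ) + α| ≤ |(h : ℝ)| + 1 := (abs_add_le _ _).trans (by rw [abs_of_nonneg hα0]; gcongr)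
  have h8 : |(h' : ℝ)| ≤ |(h' : ℝ) + α| + 1 := by
    have := abs_sub ((h' : ℝ) + α) α
    rw [add_sub_cancel_right, abs_of_nonneg hα0] at this
    linarith
  linarith [abs_nonneg (h : ℝ)]

lemma mem_Ioc_floor {M : ℝ} (hM : 0 ≤ M) {m : ℕ} (hm : m ∈ Ioc ⌊M⌋₊ ⌊2 * M⌋₊) :
    M < (m : ℝ) ∧ (m : ℝ) ≤ 2 * M := by
  rw [mem_Ioc] at hm
  exact ⟨(Nat.floor_lt hM).1 hm.1, (Nat.le_floor_iff (by linarith)).1 hm.2⟩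

lemma card_rat_le (Q : Finset ℚ) (V : ℝ) (hV : 1 ≤ V)
    (h : ∀ q ∈ Q, 0 ≤ q ∧ q ≤ 2 ∧ (q.den : ℝ) ≤ V) : (#Q : ℝ) ≤ 3 * V ^ 2 := by
  have h1 : #Q ≤ #((range (2 * ⌊V⌋₊ + 1)) ×ˢ (Ioc 0 ⌊V⌋₊)) := by
    refine card_le_card_of_injOn (fun q => (q.num.toNat, q.den)) ?_ ?_
    · intro q hq
      obtain ⟨h0, h2, h3⟩ := h q hq
      have h4 : q.den ≤ ⌊V⌋₊ := Nat.le_floor h3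
      have h5 : q.num ≤ 2 * q.den := by
        have h6 : (q.num : ℚ) ≤ 2 * q.den := by
          have hd : (0 : ℚ) < q.den := by exact_mod_cast q.den_pos
          rw [← Rat.num_div_den q, div_le_iff₀ hd] at h2
          simpa using h2
        exact_mod_cast h6
      have h7 := q.den_pos
      simp only [coe_product, Set.mem_prod, mem_coe, mem_range, mem_Ioc]
      omega
    · intro q hq q' hq' hqq
      have h0 := Rat.num_nonneg.2 (h q hq).1
      have h0' := Rat.num_nonneg.2 (h q' hq').1
      simp only [Prod.mk.injEq] at hqq
      exact Rat.ext (by omega) hqq.2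
  have h2 : (#((range (2 * ⌊V⌋₊ + 1)) ×ˢ (Ioc 0 ⌊V⌋₊)) : ℝ) = (2 * ⌊V⌋₊ + 1) * ⌊V⌋₊ := by
    simp
  have h3 : (⌊V⌋₊ : ℝ) ≤ V := Nat.floor_le (by linarith)
  have h4 : (#Q : ℝ) ≤ _ := Nat.cast_le.2 h1
  rw [h2] at h4
  calc (#Q : ℝ) ≤ (2 * ⌊V⌋₊ + 1) * ⌊V⌋₊ := h4
    _ ≤ (2 * V + 1) * V := by gcongr
    _ ≤ 3 * V ^ 2 := by nlinarith

lemma card_filter_ratio_le {M : ℝ} (hM : 1 ≤ M) (F : Finset (ℕ × ℕ)) (q : ℚ)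
    (hF : ∀ p ∈ F, p.2 ∈ Ioc ⌊M⌋₊ ⌊2 * M⌋₊ ∧ (p.1 : ℚ) / p.2 = q) :
    (#F : ℝ) ≤ 2 * M * (1 / q.den) := by
  have h1 : #F ≤ #{n ∈ Ioc 0 ⌊2 * M⌋₊ | q.den ∣ n} := by
    refine card_le_card_of_injOn Prod.snd ?_ ?_
    · intro p hp
      obtain ⟨h1, h2⟩ := hF p hp
      have h3 := Rat.den_dvd p.1 p.2
      rw [Rat.divInt_eq_div, Int.cast_natCast, Int.cast_natCast, h2] at h3
      simp only [coe_filter, Set.mem_ofPred_eq, mem_Ioc] at h1 ⊢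
      exact ⟨by omega, Int.natCast_dvd_natCast.1 h3⟩
    · intro p hp p' hp' hpp
      obtain ⟨h1, h2⟩ := hF p hp
      obtain ⟨h1', h2'⟩ := hF p' hp'
      rw [← h2', hpp] at h2
      have h0 : (p'.2 : ℚ) ≠ 0 := by
        have := (mem_Ioc.1 h1').1
        exact_mod_cast (by omega : p'.2 ≠ 0)
      rw [div_left_inj' h0] at h2
      exact Prod.ext (by exact_mod_cast h2) hpp
  rw [Nat.Ioc_filter_dvd_card_eq_div] at h1
  calc (#F : ℝ) ≤ ((⌊2 * M⌋₊ / q.den : ℕ) : ℝ) := by exact_mod_cast h1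
    _ ≤ (⌊2 * M⌋₊ : ℝ) / q.den := Nat.cast_div_le
    _ ≤ 2 * M / q.den := by gcongr; exact Nat.floor_le (by linarith)
    _ = _ := by ring

/-- The number of near coincidences `(h + α) m^c ≈ (j + α) n^c` for fixed `h`. -/
lemma card_resonance_le {c α τ θ M : ℝ} (hc : 1 ≤ c) (hc3 : c ≤ 3) (hM : 1 ≤ M) (hτ : 0 < τ)
    (hα : τ ≤ α) (hα1 : α ≤ 1 - τ) (hθ : 0 < θ) (hθ1 : θ < 1 / 2)
    (hθτ : 2 * θ * (2 * M) ^ c < τ) (H : Finset ℤ) (h : ℤ) :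
    (#{p ∈ H ×ˢ (Ioc ⌊M⌋₊ ⌊2 * M⌋₊ ×ˢ Ioc ⌊M⌋₊ ⌊2 * M⌋₊) |
      |((h : ℝ) + α) * (p.2.1 : ℝ) ^ c - ((p.1 : ℝ) + α) * (p.2.2 : ℝ) ^ c| ≤ θ} : ℝ) ≤
      48 * M * (1 + |(h : ℝ)|) ^ (2 / 3 : ℝ) := by
  set I := Ioc ⌊M⌋₊ ⌊2 * M⌋₊ with hI
  have hmem : ∀ m ∈ I, M < (m : ℝ) ∧ (m : ℝ) ≤ 2 * M := fun m hm =>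
    mem_Ioc_floor (by linarith) hm
  let F : ℤ → Finset (ℕ × ℕ) := fun h' => {p ∈ I ×ˢ I |
    |((h : ℝ) + α) * (p.1 : ℝ) ^ c - ((h' : ℝ) + α) * (p.2 : ℝ) ^ c| ≤ θ}
  have hFmem : ∀ h' p, p ∈ F h' ↔ (p.1 ∈ I ∧ p.2 ∈ I) ∧
      |((h : ℝ) + α) * (p.1 : ℝ) ^ c - ((h' : ℝ) + α) * (p.2 : ℝ) ^ c| ≤ θ := by
    intro h' p
    simp only [F, mem_filter, mem_product]
  let J := H.filter fun h' => (F h').Nonempty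
  have hJ : ∀ h' ∈ J, ∃ p, p ∈ F h' := fun h' hh => (mem_filter.1 hh).2
  choose! r hr using hJ
  let q : ℤ → ℚ := fun h' => ((r h').1 : ℚ) / (r h').2
  have hpos : ∀ n ∈ I, 1 ≤ n := fun n hn => by
    have := (mem_Ioc.1 hn).1
    omega
  -- the fibre over each value of the second frequency
  have hfib : ∀ h' ∈ J, (#(F h') : ℝ) ≤ 2 * M * (1 / (q h').den) := by
    intro h' hh
    refine card_filter_ratio_le hM _ _ fun p hp => ?_
    have h1 := (hFmem _ _).1 hp
    have h2 := (hFmem _ _).1 (hr h' hh)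
    refine ⟨h1.1.2, ?_⟩
    have h3 := resonance_ratio_eq hc hα hα1 hθτ h h' _ _ _ _ (hmem _ h1.1.2).2 (hmem _ h2.1.2).2
      hθ.le h1.2 h2.2
    have h4 : (p.2 : ℚ) ≠ 0 := by have := hpos _ h1.1.2; exact_mod_cast (by omega : p.2 ≠ 0)
    have h5 : ((r h').2 : ℚ) ≠ 0 := by
      have := hpos _ h2.1.2; exact_mod_cast (by omega : (r h').2 ≠ 0)
    rw [div_eq_div_iff h4 h5]
    exact_mod_cast h3
  have hinj : Set.InjOn q J := by
    intro h₁ hh₁ h₂ hh₂ heq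
    have h1 := (hFmem _ _).1 (hr h₁ hh₁)
    have h2 := (hFmem _ _).1 (hr h₂ hh₂)
    have p1 := hpos _ h1.1.2
    have p2 := hpos _ h2.1.2
    refine resonance_int_eq (by linarith) hθ hθ1 h h₁ h₂ _ _ _ _ p1 p2 h1.2 h2.2 ?_
    have h4 : ((r h₁).2 : ℚ) ≠ 0 := by exact_mod_cast (by omega : (r h₁).2 ≠ 0)
    have h5 : ((r h₂).2 : ℚ) ≠ 0 := by exact_mod_cast (by omega : (r h₂).2 ≠ 0)
    have h6 : ((r h₁).1 : ℚ) / (r h₁).2 = ((r h₂).1 : ℚ) / (r h₂).2 := heq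
    rw [div_eq_div_iff h4 h5] at h6
    exact_mod_cast h6
  set t := 1 + |(h : ℝ)| with ht
  have ht1 : 1 ≤ t := by rw [ht]; linarith [abs_nonneg (h : ℝ)]
  have hJcard : (#J : ℝ) ≤ 21 * t := by
    have h1 : J ⊆ Icc (-(10 * (1 + |h|))) (10 * (1 + |h|)) := by
      intro h' hh
      have h2 := (hFmem _ _).1 (hr h' hh)
      have h3 := resonance_int_le (by linarith) hc3 (by linarith) (by linarith)
        (by linarith) h h' _ _ hM (hmem _ h2.1.1).2 (hmem _ h2.1.2).1.le h2.2
      have h4 : |h'| ≤ 10 * (1 + |h|) := by exact_mod_cast h3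
      rw [mem_Icc]
      exact abs_le.1 h4
    have h2 := card_le_card h1
    rw [Int.card_Icc] at h2
    have h3 : (#J : ℤ) ≤ 20 * (1 + |h|) + 1 := by have := abs_nonneg h; omega
    have h4 : (#J : ℝ) ≤ 20 * (1 + |(h : ℝ)|) + 1 := by exact_mod_cast h3
    linarith
  set V := t ^ (1 / 3 : ℝ) with hV
  have hV1 : 1 ≤ V := Real.one_le_rpow ht1 (by norm_num)
  have hV2 : V ^ 2 = t ^ (2 / 3 : ℝ) := by
    rw [hV, ← Real.rpow_natCast, ← Real.rpow_mul (by linarith)]; norm_num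
  have hV3 : t = V ^ 2 * V := by
    rw [← pow_succ, hV, ← Real.rpow_natCast, ← Real.rpow_mul (by linarith)]; norm_num
  have hcnt : (#(J.filter fun h' => ((q h').den : ℝ) ≤ V) : ℝ) ≤ 3 * V ^ 2 := by
    rw [← card_image_of_injOn (hinj.mono (coe_subset.2 (filter_subset _ _)))]
    refine card_rat_le _ V hV1 fun x hx => ?_
    obtain ⟨h', hh, rfl⟩ := mem_image.1 hx
    obtain ⟨hh1, hh2⟩ := mem_filter.1 hh
    have h2 := (hFmem _ _).1 (hr h' hh1)
    refine ⟨by positivity, ?_, hh2⟩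
    have h4 : (0 : ℚ) < (r h').2 := by exact_mod_cast hpos _ h2.1.2
    rw [div_le_iff₀ h4]
    have h5 := (hmem _ h2.1.1).2
    have h6 := (hmem _ h2.1.2).1
    have h7 : ((r h').1 : ℝ) ≤ 2 * (r h').2 := by linarith
    exact_mod_cast h7
  have hT : #{p ∈ H ×ˢ (I ×ˢ I) |
      |((h : ℝ) + α) * (p.2.1 : ℝ) ^ c - ((p.1 : ℝ) + α) * (p.2.2 : ℝ) ^ c| ≤ θ} =
      ∑ h' ∈ J, #(F h') := by
    rw [card_filter, sum_product, sum_filter_of_ne]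
    · refine sum_congr rfl fun h' _ => ?_
      rw [card_filter]
    · intro h' _ hne
      exact card_ne_zero.1 hne
  rw [hT]
  push_cast
  calc ∑ h' ∈ J, (#(F h') : ℝ) ≤ ∑ h' ∈ J, 2 * M * (1 / V +
        if ((q h').den : ℝ) ≤ V then 1 else 0) := by
        refine sum_le_sum fun h' hh => (hfib h' hh).trans ?_
        gcongr
        split_ifs with hd
        · have h1 : (1 : ℝ) ≤ (q h').den := by exact_mod_cast (q h').den_pos
          have h2 : 1 / ((q h').den : ℝ) ≤ 1 := by rw [div_le_one (by linarith)]; exact h1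
          have h3 : 0 ≤ 1 / V := by positivity
          linarith
        · rw [add_zero]
          exact one_div_le_one_div_of_le (by linarith) (le_of_lt (not_le.1 hd))
    _ = 2 * M * (#J / V + #(J.filter fun h' => ((q h').den : ℝ) ≤ V)) := by
        rw [← mul_sum, sum_add_distrib, sum_const, nsmul_eq_mul, sum_boole]
        ring
    _ ≤ 2 * M * (21 * V ^ 2 + 3 * V ^ 2) := by
        gcongr
        rw [div_le_iff₀ (by linarith)]
        calc (#J : ℝ) ≤ 21 * t := hJcard
          _ = _ := by rw [hV3]; ring
    _ = _ := by rw [hV2]; ring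

lemma summable_one_add_abs_rpow {p : ℝ} (hp : 1 < p) :
    Summable fun h : ℤ => (1 + |(h : ℝ)|) ^ (-p) := by
  have h1 : Summable fun n : ℕ => (1 + |((n : ℤ) : ℝ)|) ^ (-p) := by
    have h2 := (Real.summable_one_div_nat_add_rpow 1 p).2 hp
    refine h2.congr fun n => ?_
    have h3 : (0 : ℝ) ≤ n := Nat.cast_nonneg n
    rw [abs_of_nonneg (by linarith), Int.cast_natCast, abs_of_nonneg h3, one_div,
      ← Real.rpow_neg (by linarith), add_comm]
  refine Summable.of_nat_of_neg h1 (h1.congr fun n => ?_)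
  rw [Int.cast_neg, abs_neg]

lemma sum_sum_symm_le {ι : Type*} (J : Finset ι) (u : ι → ℝ) (R : ι → ι → Prop)
    (hR : ∀ i j, R i j ↔ R j i) :
    ∑ i ∈ J, ∑ j ∈ J, (u i * u j * if R i j then 1 else 0) ≤
      ∑ i ∈ J, u i ^ 2 * #{j ∈ J | R i j} := by
  have e : ∑ i ∈ J, ∑ j ∈ J, (u j ^ 2 * if R i j then (1 : ℝ) else 0) =
      ∑ i ∈ J, ∑ j ∈ J, (u i ^ 2 * if R i j then (1 : ℝ) else 0) := by
    rw [sum_comm]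
    exact sum_congr rfl fun i _ => sum_congr rfl fun j _ => by simp only [hR]
  have e2 : ∑ i ∈ J, u i ^ 2 * (#{j ∈ J | R i j} : ℝ) =
      ∑ i ∈ J, ∑ j ∈ J, (u i ^ 2 * if R i j then (1 : ℝ) else 0) := by
    refine sum_congr rfl fun i _ => ?_
    rw [← mul_sum, sum_boole]
  have h1 : ∑ i ∈ J, ∑ j ∈ J, (u i * u j * if R i j then (1 : ℝ) else 0) ≤
      ∑ i ∈ J, ∑ j ∈ J, ((u i ^ 2 * if R i j then (1 : ℝ) else 0) / 2 +
        (u j ^ 2 * if R i j then (1 : ℝ) else 0) / 2) := by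
    refine sum_le_sum fun i _ => sum_le_sum fun j _ => ?_
    split_ifs
    · nlinarith [sq_nonneg (u i - u j)]
    · simp
  refine h1.trans ?_
  simp only [sum_add_distrib, ← sum_div]
  rw [e, e2]
  linarith

/-- The Type II bound when the `m`-range is so short that near coincidences of the frequencies
dominate. -/
lemma exists_bilinear_resonant_le (c : ℝ) (hc1 : 1 < c) (hc2 : c < 3) (hc3 : c ≠ 2) :
    ∃ B > 0, ∀ (Hs : Finset ℤ) (ch : ℤ → ℂ) (a b : ℕ → ℂ)
      (α τ θ s X M K L Λ A G₁ G₂ : ℝ),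
      0 ≤ s → s ≤ 1 / 30 → 1 ≤ X → X ^ (1 / 2 : ℝ) ≤ K → 1 ≤ M → 0 < τ → τ ≤ α → α ≤ 1 - τ →
      0 < θ → θ < 1 / 2 → 2 * θ * (2 * M) ^ c < τ → θ * K ^ c = X ^ (1 / 10 : ℝ) →
      (∀ h ∈ Hs, |(h : ℝ)| ≤ L) → 2 * (L + 1) * (2 * M) ^ c * K ^ c ≤ K ^ 4 * X ^ (-(14 * s)) →
      ∑ h ∈ Hs, 1 / (1 + |(h : ℝ)|) ≤ Λ → Λ ^ 2 * M * X ^ (-s) ≤ 1 → 0 ≤ A → 0 ≤ G₁ →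
      0 ≤ G₂ → (∀ h ∈ Hs, ‖ch h‖ ≤ A / (1 + |(h : ℝ)|)) →
      (∀ m ∈ Ioc ⌊M⌋₊ ⌊2 * M⌋₊, ‖a m‖ ≤ G₁) → (∀ k ∈ Ioc ⌊K⌋₊ ⌊2 * K⌋₊, ‖b k‖ ≤ G₂) →
      ‖∑ k ∈ Ioc ⌊K⌋₊ ⌊2 * K⌋₊, b k * ∑ j ∈ Hs ×ˢ Ioc ⌊M⌋₊ ⌊2 * M⌋₊,
        (ch j.1 * a j.2) * eC ((((j.1 : ℝ) + α) * (j.2 : ℝ) ^ c) * (k : ℝ) ^ c)‖ ^ 2 ≤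
        B * ((A * G₁ * G₂ * K) ^ 2 * M) := by
  obtain ⟨B, hB, hsave⟩ := exists_norm_sum_monomial_le_saving c hc1 hc2 hc3
  set Z := ∑' h : ℤ, (1 + |(h : ℝ)|) ^ (-(4 / 3 : ℝ)) with hZ
  have hZ0 : 0 ≤ Z := tsum_nonneg fun h => by positivity
  refine ⟨2 * (96 * Z + 4 * B), by positivity, fun Hs ch a b α τ θ s X M K L Λ A G₁ G₂ hs hs1 hX
    hK hM hτ hα hα1 hθ hθ1 hθτ hθK hL hup hΛ hΛM hA hG₁ hG₂ hch ha hb => ?_⟩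
  have hX0 : 0 < X := by linarith
  have hK1 : 1 ≤ K := le_trans (Real.one_le_rpow hX (by norm_num)) hK
  have hcardK := card_Ioc_floor_le hK1
  have hcardM := card_Ioc_floor_le hM
  have hMmem : ∀ m ∈ Ioc ⌊M⌋₊ ⌊2 * M⌋₊, M < (m : ℝ) ∧ (m : ℝ) ≤ 2 * M := fun m hm =>
    mem_Ioc_floor (by linarith) hm
  set I := Ioc ⌊M⌋₊ ⌊2 * M⌋₊ with hI
  set S := Ioc ⌊K⌋₊ ⌊2 * K⌋₊ with hS
  let β : ℤ × ℕ → ℝ := fun j => ((j.1 : ℝ) + α) * (j.2 : ℝ) ^ c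
  let u : ℤ × ℕ → ℝ := fun j => 1 / (1 + |(j.1 : ℝ)|)
  have hu : ∀ j, 0 ≤ u j := fun j => by positivity
  let R : ℤ × ℕ → ℤ × ℕ → Prop := fun i j => |β i - β j| ≤ θ
  have hβ : ∀ j ∈ Hs ×ˢ I, |β j| ≤ (L + 1) * (2 * M) ^ c := by
    intro j hj
    obtain ⟨h1, h2⟩ := mem_product.1 hj
    rw [abs_mul, abs_of_nonneg (by positivity : 0 ≤ (j.2 : ℝ) ^ c)]
    have h3 := hL _ h1
    have h4 : |(j.1 : ℝ) + α| ≤ L + 1 := by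
      refine (abs_add_le _ _).trans ?_
      rw [abs_of_nonneg (by linarith : 0 ≤ α)]
      linarith
    have h5 := (hMmem _ h2).2
    have h6 : 0 ≤ L + 1 := (abs_nonneg _).trans h4
    gcongr
  have hN : ∀ i ∈ Hs ×ˢ I, ∀ j ∈ Hs ×ˢ I,
      ‖∑ k ∈ S, eC ((β i - β j) * (k : ℝ) ^ c)‖ ≤
        2 * K * (if R i j then 1 else 0) + B * (K * X ^ (-s)) := by
    intro i hi j hj
    have h0 : 0 ≤ B * (K * X ^ (-s)) := by positivity
    split_ifs with hij
    · have := norm_sum_eC_le S (fun k => (β i - β j) * (k : ℝ) ^ c)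
      linarith
    · rw [mul_zero, zero_add]
      have hij' : θ < |β i - β j| := not_le.1 hij
      refine hsave s X _ K hs hs1 hX hK ?_ ?_
      · rw [← hθK]
        gcongr
      · refine le_trans ?_ hup
        have h1 := abs_sub (β i) (β j)
        have h2 := hβ i hi
        have h3 := hβ j hj
        gcongr
        linarith
  have hw : ∀ j ∈ Hs ×ˢ I, ‖ch j.1 * a j.2‖ ≤ A * G₁ * u j := by
    intro j hj
    obtain ⟨h1, h2⟩ := mem_product.1 hj
    rw [norm_mul]
    calc _ ≤ A / (1 + |(j.1 : ℝ)|) * G₁ :=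
          mul_le_mul (hch _ h1) (ha _ h2) (norm_nonneg _) (by positivity)
      _ = _ := by simp only [u]; ring
  have hdiag : ∑ i ∈ Hs ×ˢ I, u i ^ 2 * (#{j ∈ Hs ×ˢ I | R i j} : ℝ) ≤ 48 * M * Z := by
    rw [sum_product]
    calc _ ≤ ∑ h ∈ Hs, 48 * M * (1 + |(h : ℝ)|) ^ (-(4 / 3 : ℝ)) := by
          refine sum_le_sum fun h _ => ?_
          have hpos : 0 < 1 + |(h : ℝ)| := by positivity
          have h1 := card_resonance_le hc1.le hc2.le hM hτ hα hα1 hθ hθ1 hθτ Hs h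
          have h2 : ∑ m ∈ I, (#{j ∈ Hs ×ˢ I | R (h, m) j} : ℝ) ≤
              48 * M * (1 + |(h : ℝ)|) ^ (2 / 3 : ℝ) := by
            refine le_trans (le_of_eq ?_) h1
            rw [← Nat.cast_sum]
            congr 1
            simp only [card_filter]
            rw [sum_product]
            simp only [sum_product]
            rw [sum_comm]
          calc ∑ m ∈ I, u (h, m) ^ 2 * (#{j ∈ Hs ×ˢ I | R (h, m) j} : ℝ)
              = (1 / (1 + |(h : ℝ)|)) ^ 2 * ∑ m ∈ I, (#{j ∈ Hs ×ˢ I | R (h, m) j} : ℝ) := by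
                rw [mul_sum]
            _ ≤ (1 / (1 + |(h : ℝ)|)) ^ 2 * (48 * M * (1 + |(h : ℝ)|) ^ (2 / 3 : ℝ)) := by
                gcongr
            _ = 48 * M * ((1 + |(h : ℝ)|) ^ (-(2 : ℝ)) * (1 + |(h : ℝ)|) ^ (2 / 3 : ℝ)) := by
                rw [Real.rpow_neg hpos.le, Real.rpow_two, one_div, inv_pow]
                ring
            _ = _ := by
                rw [← Real.rpow_add hpos]
                norm_num
      _ = 48 * M * ∑ h ∈ Hs, (1 + |(h : ℝ)|) ^ (-(4 / 3 : ℝ)) := by rw [mul_sum]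
      _ ≤ _ := by
          gcongr
          exact (summable_one_add_abs_rpow (by norm_num)).sum_le_tsum _ fun h _ => by positivity
  have hsumu : ∑ j ∈ Hs ×ˢ I, u j ≤ Λ * (2 * M) := by
    rw [sum_product]
    have h1 : ∀ h ∈ Hs, ∑ m ∈ I, u (h, m) = #I * (1 / (1 + |(h : ℝ)|)) := fun h _ => by
      simp only [u, sum_const, nsmul_eq_mul]
    rw [sum_congr rfl h1, ← mul_sum, mul_comm]
    have h2 : 0 ≤ Λ := le_trans (sum_nonneg fun h _ => by positivity) hΛ
    gcongr
  have hbig : ∑ i ∈ Hs ×ˢ I, ∑ j ∈ Hs ×ˢ I, ‖ch i.1 * a i.2‖ * ‖ch j.1 * a j.2‖ *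
      ‖∑ k ∈ S, eC ((β i - β j) * (k : ℝ) ^ c)‖ ≤
      (A * G₁) ^ 2 * (96 * Z + 4 * B) * (K * M) := by
    calc _ ≤ ∑ i ∈ Hs ×ˢ I, ∑ j ∈ Hs ×ˢ I, (A * G₁ * u i) * (A * G₁ * u j) *
          (2 * K * (if R i j then 1 else 0) + B * (K * X ^ (-s))) := by
          refine sum_le_sum fun i hi => sum_le_sum fun j hj => ?_
          have h1 := hw i hi
          have h2 := hw j hj
          have h3 := hN i hi j hj
          have h4 := hu i
          have h5 := hu j
          gcongr
      _ = (A * G₁) ^ 2 * (2 * K * ∑ i ∈ Hs ×ˢ I, ∑ j ∈ Hs ×ˢ I,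
            (u i * u j * if R i j then 1 else 0) +
            B * (K * X ^ (-s)) * (∑ j ∈ Hs ×ˢ I, u j) ^ 2) := by
          rw [sq (∑ j ∈ Hs ×ˢ I, u j), sum_mul_sum]
          simp only [mul_sum, ← sum_add_distrib]
          refine sum_congr rfl fun i _ => sum_congr rfl fun j _ => ?_
          ring
      _ ≤ (A * G₁) ^ 2 * (2 * K * (48 * M * Z) + B * (K * X ^ (-s)) * (Λ * (2 * M)) ^ 2) := by
          have h0 : 0 ≤ ∑ j ∈ Hs ×ˢ I, u j := sum_nonneg fun j _ => hu j
          gcongr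
          exact (sum_sum_symm_le _ _ _ fun i j => by simp only [R, abs_sub_comm]).trans hdiag
      _ = (A * G₁) ^ 2 * (96 * Z + 4 * B * (Λ ^ 2 * M * X ^ (-s))) * (K * M) := by ring
      _ ≤ (A * G₁) ^ 2 * (96 * Z + 4 * B * 1) * (K * M) := by gcongr
      _ = _ := by ring
  calc _ ≤ (#S * G₂ ^ 2) * _ := bilinear_sq_le _ _ _ _ β c G₂ hb
    _ ≤ (2 * K * G₂ ^ 2) * ((A * G₁) ^ 2 * (96 * Z + 4 * B) * (K * M)) := by gcongr
    _ = _ := by ring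

lemma rpow_sub_rpow_bounds {c M x y : ℝ} (hc : 1 ≤ c) (hc3 : c ≤ 3) (hM : 0 < M) (hy : M ≤ y)
    (hxy : y < x) (hx : x ≤ 2 * M) :
    M ^ (c - 1) * (x - y) ≤ x ^ c - y ^ c ∧ x ^ c - y ^ c ≤ 12 * M ^ (c - 1) * (x - y) := by
  obtain ⟨ξ, hξ, h⟩ := exists_hasDerivAt_eq_slope (fun t : ℝ => t ^ c)
    (fun t : ℝ => c * t ^ (c - 1)) hxy
    (fun t ht => (Real.continuousAt_rpow_const _ _
      (Or.inl (by linarith [ht.1] : 0 < t).ne')).continuousWithinAt)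
    (fun t ht => Real.hasDerivAt_rpow_const (Or.inl (by linarith [ht.1] : 0 < t).ne'))
  have hd : 0 < x - y := by linarith
  rw [eq_div_iff hd.ne'] at h
  have h1 : M ^ (c - 1) ≤ ξ ^ (c - 1) :=
    Real.rpow_le_rpow hM.le (by linarith [hξ.1]) (by linarith)
  have h2 : ξ ^ (c - 1) ≤ 4 * M ^ (c - 1) := by
    calc ξ ^ (c - 1) ≤ (2 * M) ^ (c - 1) :=
          Real.rpow_le_rpow (by linarith [hξ.1]) (by linarith [hξ.2]) (by linarith)
      _ = 2 ^ (c - 1) * M ^ (c - 1) := Real.mul_rpow (by norm_num) hM.le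
      _ ≤ 2 ^ (2 : ℝ) * M ^ (c - 1) := by
          gcongr
          · norm_num
          · linarith
      _ = _ := by norm_num
  have h0 : 0 < M ^ (c - 1) := by positivity
  rw [← h]
  exact ⟨mul_le_mul_of_nonneg_right (by nlinarith) hd.le,
    mul_le_mul_of_nonneg_right (by nlinarith) hd.le⟩

/-- The Type II bound for a single frequency `γ`, by cutting the `m`-range in blocks of length
`q`. -/
lemma exists_bilinear_blocks_le (c : ℝ) (hc1 : 1 < c) (hc2 : c < 3) (hc3 : c ≠ 2) :
    ∃ B > 0, ∀ (a b : ℕ → ℂ) (q : ℕ) (γ s X M K G₁ G₂ : ℝ),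
      0 ≤ s → s ≤ 1 / 30 → 1 ≤ X → X ^ (1 / 2 : ℝ) ≤ K → 1 ≤ q → (q : ℝ) ≤ X ^ s → (q : ℝ) ≤ M →
      X ^ (1 / 10 : ℝ) ≤ |γ| * M ^ (c - 1) * K ^ c →
      12 * |γ| * M ^ (c - 1) * q * K ^ c ≤ K ^ 4 * X ^ (-(14 * s)) → 0 ≤ G₁ → 0 ≤ G₂ →
      (∀ m ∈ Ioc ⌊M⌋₊ ⌊2 * M⌋₊, ‖a m‖ ≤ G₁) → (∀ k ∈ Ioc ⌊K⌋₊ ⌊2 * K⌋₊, ‖b k‖ ≤ G₂) →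
      ‖∑ k ∈ Ioc ⌊K⌋₊ ⌊2 * K⌋₊, b k * ∑ m ∈ Ioc ⌊M⌋₊ ⌊2 * M⌋₊,
        a m * eC ((γ * (m : ℝ) ^ c) * (k : ℝ) ^ c)‖ ≤ B * (G₁ * G₂ * K * M / √q) := by
  obtain ⟨B, hB, hsp⟩ := exists_bilinear_spaced_le c hc1 hc2 hc3
  refine ⟨3 * B, by positivity, fun a b q γ s X M K G₁ G₂ hs hs1 hX hK hq hqX hqM hlow hup hG₁ hG₂
    ha hb => ?_⟩
  have hq0 : (1 : ℝ) ≤ q := by exact_mod_cast hq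
  have hM : 1 ≤ M := hq0.trans hqM
  have hX0 : 0 < X := by linarith
  have hK1 : 1 ≤ K := le_trans (Real.one_le_rpow hX (by norm_num)) hK
  have hMmem : ∀ m ∈ Ioc ⌊M⌋₊ ⌊2 * M⌋₊, M < (m : ℝ) ∧ (m : ℝ) ≤ 2 * M := fun m hm =>
    mem_Ioc_floor (by linarith) hm
  set I := Ioc ⌊M⌋₊ ⌊2 * M⌋₊ with hI
  set T := range (⌊2 * M⌋₊ / q + 1) with hT
  have hmaps : ∀ m ∈ I, m / q ∈ T := fun m hm => by
    have := Nat.div_le_div_right (c := q) (mem_Ioc.1 hm).2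
    rw [hT, mem_range]
    omega
  have hTcard : (#T : ℝ) ≤ 3 * M / q := by
    rw [hT, card_range]
    push_cast
    have h1 : ((⌊2 * M⌋₊ / q : ℕ) : ℝ) ≤ 2 * M / q :=
      Nat.cast_div_le.trans (by gcongr; exact Nat.floor_le (by linarith))
    have h2 : 1 ≤ M / q := (one_le_div (by linarith)).2 hqM
    have h3 : 3 * M / q = 2 * M / q + M / q := by ring
    linarith
  have hsplit : ∑ k ∈ Ioc ⌊K⌋₊ ⌊2 * K⌋₊, b k * ∑ m ∈ I,
      a m * eC ((γ * (m : ℝ) ^ c) * (k : ℝ) ^ c) =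
      ∑ t ∈ T, ∑ k ∈ Ioc ⌊K⌋₊ ⌊2 * K⌋₊, b k * ∑ m ∈ I with m / q = t,
        a m * eC ((γ * (m : ℝ) ^ c) * (k : ℝ) ^ c) := by
    rw [sum_comm]
    refine sum_congr rfl fun k _ => ?_
    rw [← mul_sum, sum_fiberwise_of_maps_to hmaps]
  have hfib : ∀ t, ∀ m ∈ I.filter (fun m => m / q = t), t * q ≤ m ∧ m < t * q + q := by
    intro t m hm
    have h1 := (mem_filter.1 hm).2
    have h2 := Nat.div_add_mod m q
    have h3 := Nat.mod_lt m (by omega : q > 0)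
    rw [h1, mul_comm] at h2
    omega
  have hcard : ∀ t, #(I.filter fun m => m / q = t) ≤ q := by
    intro t
    have h1 : I.filter (fun m => m / q = t) ⊆ Ico (t * q) (t * q + q) := fun m hm =>
      mem_Ico.2 (hfib t m hm)
    simpa using card_le_card h1
  have key : ∀ t, ∀ i ∈ I.filter (fun m => m / q = t), ∀ j ∈ I.filter (fun m => m / q = t),
      j < i → X ^ (1 / 10 : ℝ) ≤ |γ * (i : ℝ) ^ c - γ * (j : ℝ) ^ c| * K ^ c ∧
      |γ * (i : ℝ) ^ c - γ * (j : ℝ) ^ c| * K ^ c ≤ K ^ 4 * X ^ (-(14 * s)) := by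
    intro t i hi j hj hij
    have h1 := hMmem i (mem_filter.1 hi).1
    have h2 := hMmem j (mem_filter.1 hj).1
    have h3 : (i : ℝ) - j ≤ q := by
      have h4 := hfib t i hi
      have h5 := hfib t j hj
      have h6 : i ≤ q + j := by omega
      have h7 : (i : ℝ) ≤ q + j := by exact_mod_cast h6
      linarith
    have h4 : (1 : ℝ) ≤ i - j := by
      have : (j : ℝ) + 1 ≤ i := by exact_mod_cast hij
      linarith
    obtain ⟨h5, h6⟩ := rpow_sub_rpow_bounds hc1.le hc2.le (by linarith) h2.1.le
      (by linarith) h1.2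
    have h0 : 0 ≤ M ^ (c - 1) := by positivity
    have h8 : M ^ (c - 1) ≤ (i : ℝ) ^ c - (j : ℝ) ^ c := by nlinarith
    rw [← mul_sub, abs_mul, abs_of_nonneg (h0.trans h8)]
    constructor
    · refine hlow.trans ?_
      gcongr
    · refine le_trans ?_ hup
      calc |γ| * ((i : ℝ) ^ c - (j : ℝ) ^ c) * K ^ c ≤ |γ| * (12 * M ^ (c - 1) * q) * K ^ c := by
            gcongr
            refine h6.trans ?_
            gcongr
        _ = _ := by ring
  rw [hsplit]
  have hq2 : √(q : ℝ) * √(q : ℝ) = q := Real.mul_self_sqrt (by linarith)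
  have hq3 : 0 < √(q : ℝ) := Real.sqrt_pos.2 (by linarith)
  calc _ ≤ ∑ t ∈ T, B * (G₁ * G₂ * K * √q) := by
        refine norm_sum_le_of_le _ fun t _ => ?_
        refine (hsp (I.filter fun m => m / q = t) a b (fun m => γ * (m : ℝ) ^ c) s X K G₁ G₂ hs hs1
          hX hK ?_ hG₁ hG₂ (fun m hm => ha m (mem_filter.1 hm).1) hb ?_).trans ?_
        · exact le_trans (by exact_mod_cast hcard t) hqX
        · intro i hi j hj hij
          rcases lt_or_gt_of_ne hij with h | h
          · have := key t j hj i hi h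
            rwa [abs_sub_comm] at this
          · exact key t i hi j hj h
        · gcongr
          exact hcard t
    _ = #T * (B * (G₁ * G₂ * K * √q)) := by rw [sum_const, nsmul_eq_mul]
    _ ≤ (3 * M / q) * (B * (G₁ * G₂ * K * √q)) := by gcongr
    _ = _ := by
        have e : √(q : ℝ) / q = 1 / √q := by
          rw [div_eq_div_iff (by linarith) hq3.ne', one_mul, hq2]
        calc _ = 3 * M * B * G₁ * G₂ * K * (√(q : ℝ) / q) := by ring
          _ = _ := by rw [e]; ring

lemma two_le_exp_one : (2 : ℝ) ≤ exp 1 := by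
  have := Real.add_one_le_exp 1
  linarith

lemma exists_typeII_long_le (c : ℝ) (hc1 : 1 < c) (hc2 : c < 4109054 / 1999527) (hc3 : c ≠ 2) :
    ∃ B > 0, ∀ (a b : ℕ → ℂ) (γ η x l μ κ G₁ G₂ : ℝ),
      0 < η → η ≤ 1 / 1000 → 0 ≤ l → 2000 * (l + 1) ≤ x →
      7 * l + 10 ≤ (4109054 / 1999527 - c - 15 * η) * x →
      (38687 / 1333018 + η) * x ≤ μ → μ ≤ l + 11958325 / 23994324 * x → x - l ≤ μ + κ →
      exp (-((x + l) * (10000 / 9449 * (c - 9 / 10)))) ≤ |γ| →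
      |γ| ≤ 2 * exp (38687 / 2666036 * x) → 0 ≤ G₁ → 0 ≤ G₂ →
      (∀ m ∈ Ioc ⌊exp μ⌋₊ ⌊2 * exp μ⌋₊, ‖a m‖ ≤ G₁) →
      (∀ k ∈ Ioc ⌊exp κ⌋₊ ⌊2 * exp κ⌋₊, ‖b k‖ ≤ G₂) →
      ‖∑ k ∈ Ioc ⌊exp κ⌋₊ ⌊2 * exp κ⌋₊, b k * ∑ m ∈ Ioc ⌊exp μ⌋₊ ⌊2 * exp μ⌋₊,
        a m * eC ((γ * (m : ℝ) ^ c) * (k : ℝ) ^ c)‖ ≤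
        B * (G₁ * G₂ * exp (μ + κ - (38687 / 2666036 + η / 2) * x)) := by
  obtain ⟨B, hB, h⟩ := exists_bilinear_blocks_le c hc1 (by linarith) hc3
  refine ⟨2 * B, by positivity, fun a b γ η x l μ κ G₁ G₂ hη hη1 hl hx hgap hμ1 hμ2 hκ hγ1 hγ2 hG₁
    hG₂ ha hb => ?_⟩
  have hηx : η * x ≤ 1 / 1000 * x := by gcongr; linarith
  have hηx0 : 0 ≤ η * x := mul_nonneg hη.le (by linarith)
  have hcx : c * x ≤ 4109054 / 1999527 * x := by gcongr; linarith
  have hcl : c * l ≤ 4109054 / 1999527 * l := by gcongr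
  set y := (38687 / 1333018 + η) * x with hy
  have hy1 : 1 ≤ y := by rw [hy]; nlinarith
  have hey : 2 ≤ exp y := two_le_exp_one.trans (exp_le_exp.2 hy1)
  set q := ⌊exp y⌋₊ with hq
  have hq1 : 1 ≤ q := Nat.le_floor (by rw [Nat.cast_one]; linarith)
  have hq2 : (q : ℝ) ≤ exp y := Nat.floor_le (exp_pos _).le
  have hq3 : exp y / 4 ≤ q := by
    have := Nat.lt_floor_add_one (exp y)
    rw [← hq] at this
    linarith
  have hmain := h a b q γ (38687 / 1333018 + η) (exp x) (exp μ) (exp κ) G₁ G₂ (by linarith)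
    (by linarith) (one_le_exp (by linarith)) ?_ hq1 ?_ (hq2.trans (exp_le_exp.2 hμ1)) ?_ ?_ hG₁ hG₂
    ha hb
  · refine hmain.trans ?_
    have hs : exp (y / 2) / 2 ≤ √(q : ℝ) := by
      refine Real.le_sqrt_of_sq_le (le_trans (le_of_eq ?_) hq3)
      rw [div_pow, ← Real.exp_nat_mul]
      congr 2
      · push_cast; ring
      · norm_num
    calc _ ≤ B * (G₁ * G₂ * exp κ * exp μ / (exp (y / 2) / 2)) := by gcongr
      _ = 2 * B * (G₁ * G₂ * (exp κ * exp μ * exp (-(y / 2)))) := by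
          rw [Real.exp_neg]
          field_simp
      _ = _ := by
          rw [← Real.exp_add, ← Real.exp_add, hy]
          congr 3
          ring
  · rw [← Real.exp_mul, exp_le_exp]
    linarith
  · rw [← Real.exp_mul, mul_comm x]
    exact hq2
  · have h1 : c * (x - l) ≤ c * (μ + κ) := by gcongr
    calc exp x ^ (1 / 10 : ℝ) = exp (x * (1 / 10)) := (Real.exp_mul _ _).symm
      _ ≤ exp (-((x + l) * (10000 / 9449 * (c - 9 / 10))) + μ * (c - 1) + κ * c) := by
          rw [exp_le_exp]
          nlinarith
      _ = exp (-((x + l) * (10000 / 9449 * (c - 9 / 10)))) * exp μ ^ (c - 1) * exp κ ^ c := by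
          rw [Real.exp_add, Real.exp_add, Real.exp_mul μ, Real.exp_mul κ]
      _ ≤ _ := by gcongr
  · have h1 : (4 - c) * (x - l) ≤ (4 - c) * (μ + κ) := by
      apply mul_le_mul_of_nonneg_left hκ
      linarith
    have h24 : (24 : ℝ) ≤ exp 5 := by
      have h2 : (2 : ℝ) ^ 5 ≤ exp 1 ^ 5 := by gcongr; exact two_le_exp_one
      rw [← Real.exp_nat_mul] at h2
      norm_num at h2
      linarith
    calc 12 * |γ| * exp μ ^ (c - 1) * q * exp κ ^ c
        ≤ 12 * (2 * exp (38687 / 2666036 * x)) * exp μ ^ (c - 1) * exp y * exp κ ^ c := by gcongr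
      _ = 24 * exp (38687 / 2666036 * x) * exp μ ^ (c - 1) * exp y * exp κ ^ c := by ring
      _ ≤ exp 5 * exp (38687 / 2666036 * x) * exp μ ^ (c - 1) * exp y * exp κ ^ c := by gcongr
      _ = exp (5 + 38687 / 2666036 * x + μ * (c - 1) + y + κ * c) := by
          rw [Real.exp_add, Real.exp_add, Real.exp_add, Real.exp_add, Real.exp_mul μ,
            Real.exp_mul κ]
      _ ≤ exp ((4 : ℕ) * κ + x * (-(14 * (38687 / 1333018 + η)))) := by
          rw [exp_le_exp]
          push_cast
          rw [hy]
          nlinarith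
      _ = _ := by rw [Real.exp_add, Real.exp_nat_mul, Real.exp_mul x]

lemma exists_typeII_short_le (c : ℝ) (hc1 : 1 < c) (hc2 : c < 4109054 / 1999527) (hc3 : c ≠ 2) :
    ∃ B > 0, ∀ (Hs : Finset ℤ) (ch : ℤ → ℂ) (a b : ℕ → ℂ) (α τ η x l μ κ A G₁ G₂ : ℝ),
      0 < η → η ≤ 1 / 1000 → 0 ≤ l → 2000 * (l + 1) ≤ x →
      38687 / 1333018 * x - l ≤ μ → μ ≤ (38687 / 1333018 + η) * x →
      x - l ≤ μ + κ → μ + κ ≤ x + l → τ ≤ α → α ≤ 1 - τ →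
      exp (-((x + l) * (10000 / 9449 * (c - 9 / 10)))) ≤ τ →
      (∀ h ∈ Hs, |(h : ℝ)| ≤ exp (38687 / 2666036 * x)) →
      ∑ h ∈ Hs, 1 / (1 + |(h : ℝ)|) ≤ exp (η / 2 * x) → 0 ≤ A → 0 ≤ G₁ → 0 ≤ G₂ →
      (∀ h ∈ Hs, ‖ch h‖ ≤ A / (1 + |(h : ℝ)|)) →
      (∀ m ∈ Ioc ⌊exp μ⌋₊ ⌊2 * exp μ⌋₊, ‖a m‖ ≤ G₁) →
      (∀ k ∈ Ioc ⌊exp κ⌋₊ ⌊2 * exp κ⌋₊, ‖b k‖ ≤ G₂) →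
      ‖∑ k ∈ Ioc ⌊exp κ⌋₊ ⌊2 * exp κ⌋₊, b k * ∑ j ∈ Hs ×ˢ Ioc ⌊exp μ⌋₊ ⌊2 * exp μ⌋₊,
        (ch j.1 * a j.2) * eC ((((j.1 : ℝ) + α) * (j.2 : ℝ) ^ c) * (k : ℝ) ^ c)‖ ≤
        B * (A * G₁ * G₂ * exp (μ + κ + l / 2 - 38687 / 2666036 * x)) := by
  obtain ⟨B, hB, h⟩ := exists_bilinear_resonant_le c hc1 (by linarith) hc3
  refine ⟨√B, by positivity, fun Hs ch a b α τ η x l μ κ A G₁ G₂ hη hη1 hl hx hμ1 hμ2 hκ1 hκ2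
    hα1 hα2 hτ hH hΛ hA hG₁ hG₂ hch ha hb => ?_⟩
  have hηx : η * x ≤ 1 / 1000 * x := by gcongr; linarith
  have hηx0 : 0 ≤ η * x := mul_nonneg hη.le (by linarith)
  have hcx : c * x ≤ 4109054 / 1999527 * x := by gcongr; linarith
  have hcl : c * l ≤ 4109054 / 1999527 * l := by gcongr
  have hcκ : κ ≤ c * κ := le_mul_of_one_le_left (by nlinarith) hc1.le
  have hcμ : c * μ ≤ 4109054 / 1999527 * μ := by gcongr; linarith
  have h2 := two_le_exp_one
  have hmain := h Hs ch a b α τ (exp (x * (1 / 10) - κ * c)) (38687 / 1333018 + 2 * η) (exp x)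
    (exp μ) (exp κ) (exp (38687 / 2666036 * x)) (exp (η / 2 * x)) A G₁ G₂ (by linarith)
    (by linarith) (one_le_exp (by linarith)) ?_ (one_le_exp (by linarith))
    ((exp_pos _).trans_le hτ) hα1 hα2 (exp_pos _) ?_ ?_ ?_ hH ?_ hΛ ?_ hA hG₁ hG₂ hch ha hb
  · refine le_of_sq_le_sq (hmain.trans ?_) (by positivity)
    rw [mul_pow √B, Real.sq_sqrt hB.le]
    refine mul_le_mul_of_nonneg_left ?_ hB.le
    calc (A * G₁ * G₂ * exp κ) ^ 2 * exp μ = (A * G₁ * G₂) ^ 2 * exp ((2 : ℕ) * κ + μ) := by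
          rw [Real.exp_add, Real.exp_nat_mul]; ring
      _ ≤ (A * G₁ * G₂) ^ 2 * exp ((2 : ℕ) * (μ + κ + l / 2 - 38687 / 2666036 * x)) := by
          gcongr
          push_cast
          linarith
      _ = _ := by rw [Real.exp_nat_mul]; ring
  · rw [← Real.exp_mul, exp_le_exp]
    linarith
  · have h3 : exp (x * (1 / 10) - κ * c) ≤ exp (-2) := exp_le_exp.2 (by nlinarith)
    have h4 : exp (-2 : ℝ) * exp 1 * exp 1 = 1 := by
      rw [← Real.exp_add, ← Real.exp_add]; norm_num
    have h5 : exp (-2 : ℝ) * 2 * 2 ≤ exp (-2 : ℝ) * exp 1 * exp 1 := by gcongr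
    linarith
  · refine lt_of_lt_of_le ?_ hτ
    have h3 : c * (x - l) ≤ c * (μ + κ) := by gcongr
    calc 2 * exp (x * (1 / 10) - κ * c) * (2 * exp μ) ^ c
        ≤ exp 1 * exp (x * (1 / 10) - κ * c) * (exp 1 * exp μ) ^ c := by gcongr
      _ = exp (1 + (x * (1 / 10) - κ * c) + (1 + μ) * c) := by
          rw [Real.exp_add, Real.exp_add 1, Real.exp_mul (1 + μ), Real.exp_add 1 μ]
      _ < _ := by
          rw [exp_lt_exp]
          nlinarith
  · rw [← Real.exp_mul, ← Real.exp_mul, ← Real.exp_add]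
    congr 1
    ring
  · have h3 : c * (μ + κ) ≤ c * (x + l) := by gcongr
    have h4 : (1 : ℝ) ≤ exp (38687 / 2666036 * x) := one_le_exp (by linarith)
    calc 2 * (exp (38687 / 2666036 * x) + 1) * (2 * exp μ) ^ c * exp κ ^ c
        ≤ exp 1 * (exp 1 * exp (38687 / 2666036 * x)) * (exp 1 * exp μ) ^ c * exp κ ^ c := by
          gcongr
          nlinarith
      _ = exp (1 + (1 + 38687 / 2666036 * x) + (1 + μ) * c + κ * c) := by
          rw [Real.exp_add, Real.exp_add, Real.exp_add 1, Real.exp_mul (1 + μ), Real.exp_add 1 μ,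
            Real.exp_add 1, Real.exp_mul κ]
      _ ≤ exp ((4 : ℕ) * κ + x * (-(14 * (38687 / 1333018 + 2 * η)))) := by
          rw [exp_le_exp]
          push_cast
          nlinarith
      _ = _ := by rw [Real.exp_add, Real.exp_nat_mul, Real.exp_mul x]
  · rw [← Real.exp_nat_mul, ← Real.exp_mul, ← Real.exp_add, ← Real.exp_add, exp_le_one_iff]
    push_cast
    linarith

lemma exists_sum_one_div_one_add_abs_le {η : ℝ} (hη : 0 < η) :
    ∃ x₀ : ℝ, ∀ x : ℝ, x₀ ≤ x → 0 ≤ x → ∀ Hs : Finset ℤ, (∀ h ∈ Hs, |(h : ℝ)| ≤ exp x) →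
      ∑ h ∈ Hs, 1 / (1 + |(h : ℝ)|) ≤ exp (η * x) := by
  set Z := ∑' h : ℤ, (1 + |(h : ℝ)|) ^ (-(1 + η / 2)) with hZ
  have hsum := summable_one_add_abs_rpow (by linarith : 1 < 1 + η / 2)
  refine ⟨2 / η * (Z * 2 ^ (η / 2)), fun x hx hx0 Hs hHs => ?_⟩
  have h1 : (1 : ℝ) ≤ exp x := one_le_exp hx0
  calc ∑ h ∈ Hs, 1 / (1 + |(h : ℝ)|)
      ≤ ∑ h ∈ Hs, (1 + |(h : ℝ)|) ^ (-(1 + η / 2)) * (2 * exp x) ^ (η / 2) := by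
        refine sum_le_sum fun h hh => ?_
        have hpos : 0 < 1 + |(h : ℝ)| := by positivity
        calc 1 / (1 + |(h : ℝ)|) = (1 + |(h : ℝ)|) ^ (-(1 + η / 2) + η / 2) := by
              rw [show -(1 + η / 2) + η / 2 = -1 by ring, Real.rpow_neg_one, one_div]
          _ = (1 + |(h : ℝ)|) ^ (-(1 + η / 2)) * (1 + |(h : ℝ)|) ^ (η / 2) :=
              Real.rpow_add hpos _ _
          _ ≤ _ := by
              gcongr
              linarith [hHs h hh]
    _ = (∑ h ∈ Hs, (1 + |(h : ℝ)|) ^ (-(1 + η / 2))) * (2 * exp x) ^ (η / 2) := by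
        rw [sum_mul]
    _ ≤ Z * (2 * exp x) ^ (η / 2) := by
        gcongr
        exact hsum.sum_le_tsum _ fun h _ => by positivity
    _ = Z * 2 ^ (η / 2) * exp (x * (η / 2)) := by
        rw [Real.mul_rpow (by norm_num) (exp_pos _).le, Real.exp_mul]
        ring
    _ ≤ exp (x * (η / 2)) * exp (x * (η / 2)) := by
        gcongr
        have h2 : Z * 2 ^ (η / 2) ≤ x * (η / 2) := by
          have h3 : 2 / η * (Z * 2 ^ (η / 2)) * (η / 2) ≤ x * (η / 2) := by gcongr
          refine le_trans (le_of_eq ?_) h3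
          field_simp
        linarith [Real.add_one_le_exp (x * (η / 2))]
    _ = _ := by
        rw [← Real.exp_add]
        congr 1
        ring

lemma sum_sum_eC_mul_rpow_comm (I S : Finset ℕ) (a b : ℕ → ℂ) (γ c : ℝ) :
    ∑ m ∈ I, a m * ∑ k ∈ S, b k * eC (γ * ((m * k : ℕ) : ℝ) ^ c) =
      ∑ k ∈ S, b k * ∑ m ∈ I, a m * eC ((γ * (m : ℝ) ^ c) * (k : ℝ) ^ c) := by
  simp only [mul_sum]
  rw [sum_comm]
  refine sum_congr rfl fun k _ => sum_congr rfl fun m _ => ?_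
  rw [Nat.cast_mul, Real.mul_rpow (Nat.cast_nonneg _) (Nat.cast_nonneg _), ← mul_assoc γ]
  ring

lemma sum_sum_sum_eC_mul_rpow_comm (Hs : Finset ℤ) (I S : Finset ℕ) (ch : ℤ → ℂ) (a b : ℕ → ℂ)
    (α c : ℝ) :
    ∑ h ∈ Hs, ch h * ∑ m ∈ I, a m * ∑ k ∈ S, b k *
        eC (((h : ℝ) + α) * ((m * k : ℕ) : ℝ) ^ c) =
      ∑ k ∈ S, b k * ∑ j ∈ Hs ×ˢ I,
        (ch j.1 * a j.2) * eC ((((j.1 : ℝ) + α) * (j.2 : ℝ) ^ c) * (k : ℝ) ^ c) := by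
  simp only [sum_sum_eC_mul_rpow_comm]
  simp only [sum_product, mul_sum]
  rw [sum_comm]
  refine sum_congr rfl fun k _ => sum_congr rfl fun h _ => sum_congr rfl fun m _ => ?_
  ring

/-- The Type II bound in logarithmic coordinates `X = e^x`, `M = e^μ`, `K = e^κ`, `A = e^l`. -/
lemma exists_typeII_le (c : ℝ) (hc1 : 1 < c) (hc2 : c < 4109054 / 1999527) (hc3 : c ≠ 2)
    (l : ℝ) (hl : 0 ≤ l) :
    ∃ B > 0, ∃ x₀ : ℝ, ∀ (Hs : Finset ℤ) (ch : ℤ → ℂ) (a b : ℕ → ℂ) (α τ x μ κ G₁ G₂ : ℝ),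
      x₀ ≤ x → 38687 / 1333018 * x - l ≤ μ → μ ≤ l + 11958325 / 23994324 * x →
      x - l ≤ μ + κ → μ + κ ≤ x + l → τ ≤ α → α ≤ 1 - τ →
      exp (-((x + l) * (10000 / 9449 * (c - 9 / 10)))) ≤ τ →
      (∀ h ∈ Hs, |(h : ℝ)| ≤ exp (38687 / 2666036 * x)) → 0 ≤ G₁ → 0 ≤ G₂ →
      (∀ h ∈ Hs, ‖ch h‖ ≤ exp l / (1 + |(h : ℝ)|)) →
      (∀ m ∈ Ioc ⌊exp μ⌋₊ ⌊2 * exp μ⌋₊, ‖a m‖ ≤ G₁) →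
      (∀ k ∈ Ioc ⌊exp κ⌋₊ ⌊2 * exp κ⌋₊, ‖b k‖ ≤ G₂) →
      ‖∑ h ∈ Hs, ch h * ∑ m ∈ Ioc ⌊exp μ⌋₊ ⌊2 * exp μ⌋₊, a m *
        ∑ k ∈ Ioc ⌊exp κ⌋₊ ⌊2 * exp κ⌋₊, b k * eC (((h : ℝ) + α) * ((m * k : ℕ) : ℝ) ^ c)‖ ≤
        B * (G₁ * G₂ * exp (2627349 / 2666036 * x)) := by
  obtain ⟨B₁, hB₁, hlong⟩ := exists_typeII_long_le c hc1 hc2 hc3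
  obtain ⟨B₂, hB₂, hshort⟩ := exists_typeII_short_le c hc1 hc2 hc3
  have hg : 0 < 4109054 / 1999527 - c := by linarith
  set g := 4109054 / 1999527 - c with hgdef
  set η := min (1 / 1000) (g / 30) with hη
  have hη0 : 0 < η := lt_min (by norm_num) (by positivity)
  have hη1 : η ≤ 1 / 1000 := min_le_left _ _
  have hη2 : η ≤ g / 30 := min_le_right _ _
  obtain ⟨x₁, hx₁⟩ := exists_sum_one_div_one_add_abs_le (half_pos hη0)
  refine ⟨(B₁ + B₂) * exp (3 * l), by positivity,
    max x₁ (max (2000 * (l + 1)) (2 / g * (7 * l + 10))),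
    fun Hs ch a b α τ x μ κ G₁ G₂ hx hμ1 hμ2 hκ1 hκ2 hα1 hα2 hτ hH hG₁ hG₂ hch ha hb => ?_⟩
  have hxx₁ : x₁ ≤ x := (le_max_left _ _).trans hx
  have hxl : 2000 * (l + 1) ≤ x := (le_max_left _ _).trans ((le_max_right _ _).trans hx)
  have hxg : 2 / g * (7 * l + 10) ≤ x := (le_max_right _ _).trans ((le_max_right _ _).trans hx)
  have hx0 : 0 ≤ x := by linarith
  have hΛ : ∑ h ∈ Hs, 1 / (1 + |(h : ℝ)|) ≤ exp (η / 2 * x) :=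
    hx₁ x hxx₁ hx0 Hs fun h hh => (hH h hh).trans (exp_le_exp.2 (by linarith))
  have hτ0 : 0 < τ := (exp_pos _).trans_le hτ
  rcases le_total μ ((38687 / 1333018 + η) * x) with hμ | hμ
  · rw [sum_sum_sum_eC_mul_rpow_comm]
    refine (hshort Hs ch a b α τ η x l μ κ (exp l) G₁ G₂ hη0 hη1 hl hxl hμ1 hμ hκ1 hκ2 hα1 hα2 hτ
      hH hΛ (exp_pos _).le hG₁ hG₂ hch ha hb).trans ?_
    calc B₂ * (exp l * G₁ * G₂ * exp (μ + κ + l / 2 - 38687 / 2666036 * x))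
        = B₂ * (G₁ * G₂ * exp (l + (μ + κ + l / 2 - 38687 / 2666036 * x))) := by
          rw [Real.exp_add l]; ring
      _ ≤ (B₁ + B₂) * (G₁ * G₂ * exp (3 * l + 2627349 / 2666036 * x)) := by
          exact mul_le_mul (by linarith) (mul_le_mul_of_nonneg_left (exp_le_exp.2 (by linarith))
            (by positivity)) (by positivity) (by positivity)
      _ = _ := by rw [Real.exp_add]; ring
  · have hgap : 7 * l + 10 ≤ (4109054 / 1999527 - c - 15 * η) * x := by
      rw [← hgdef]
      have h1 : g / 2 * (2 / g * (7 * l + 10)) ≤ g / 2 * x := by gcongr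
      have h2 : g / 2 * (2 / g * (7 * l + 10)) = 7 * l + 10 := by field_simp
      have h3 : g / 2 * x ≤ (g - 15 * η) * x := by
        gcongr
        linarith
      linarith
    have hone : (1 : ℝ) ≤ exp (38687 / 2666036 * x) := one_le_exp (by linarith)
    calc _ ≤ ∑ h ∈ Hs, exp l / (1 + |(h : ℝ)|) *
          (B₁ * (G₁ * G₂ * exp (μ + κ - (38687 / 2666036 + η / 2) * x))) := by
          refine norm_sum_le_of_le _ fun h hh => ?_
          rw [norm_mul, sum_sum_eC_mul_rpow_comm]
          refine mul_le_mul (hch h hh) ?_ (norm_nonneg _) (by positivity)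
          refine hlong a b _ η x l μ κ G₁ G₂ hη0 hη1 hl hxl hgap hμ hμ2 hκ1
            (hτ.trans (le_abs_int_add hα1 hα2 h)) ?_ hG₁ hG₂ ha hb
          refine (abs_add_le _ _).trans ?_
          rw [abs_of_nonneg (by linarith : 0 ≤ α)]
          linarith [hH h hh]
      _ = (∑ h ∈ Hs, 1 / (1 + |(h : ℝ)|)) * (exp l *
          (B₁ * (G₁ * G₂ * exp (μ + κ - (38687 / 2666036 + η / 2) * x)))) := by
          rw [sum_mul]
          refine sum_congr rfl fun h _ => ?_
          ring
      _ ≤ exp (η / 2 * x) * (exp l *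
          (B₁ * (G₁ * G₂ * exp (μ + κ - (38687 / 2666036 + η / 2) * x)))) := by gcongr
      _ = B₁ * (G₁ * G₂ * exp (η / 2 * x + l + (μ + κ - (38687 / 2666036 + η / 2) * x))) := by
          rw [Real.exp_add, Real.exp_add]; ring
      _ ≤ (B₁ + B₂) * (G₁ * G₂ * exp (3 * l + 2627349 / 2666036 * x)) := by
          exact mul_le_mul (by linarith) (mul_le_mul_of_nonneg_left (exp_le_exp.2 (by linarith))
            (by positivity)) (by positivity) (by positivity)
      _ = _ := by rw [Real.exp_add]; ring

theorem stmt_11 (c : ℝ) (hc1 : 1 < c) (hc2 : c < 4109054 / 1999527) (hc3 : c ≠ 2) :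
    ∃ ε₀ > 0, ∀ ε : ℝ, 0 < ε → ε ≤ ε₀ → ∀ A : ℝ, 0 < A →
      ∃ C > 0, ∃ P₀ : ℝ, ∀ P : ℝ, P₀ ≤ P →
        ∀ X M K : ℝ, 0 < M → 0 < K →
          A⁻¹ * P ^ ((9449 : ℝ) / 10000) ≤ X → X ≤ A * P →
          A⁻¹ * X ≤ M * K → M * K ≤ A * X →
          A⁻¹ * X ^ ((38687 : ℝ) / 1333018) ≤ M →
          M ≤ A * X ^ ((11958325 : ℝ) / 23994324) →
          ∀ ch : ℤ → ℂ, (∀ h : ℤ, ‖ch h‖ ≤ A / (1 + |(h : ℝ)|)) →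
          ∀ a : ℕ → ℂ, (∀ m : ℕ, ‖a m‖ ≤ A * (m : ℝ) ^ ε) →
          ∀ b : ℕ → ℂ, (∀ k : ℕ, ‖b k‖ ≤ A * (k : ℝ) ^ ε) →
          ∀ α : ℝ, P ^ (1 - c - ε) < α → α < 1 - P ^ (1 - c - ε) →
            ‖∑ h ∈ Finset.Icc (-⌊X ^ ((38687 : ℝ) / 2666036)⌋) ⌊X ^ ((38687 : ℝ) / 2666036)⌋,
                ch h * ∑ m ∈ Finset.Ioc ⌊M⌋₊ ⌊2 * M⌋₊, a m *
                  ∑ k ∈ Finset.Ioc ⌊K⌋₊ ⌊2 * K⌋₊, b k *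
                    eC (((h : ℝ) + α) * ((m * k : ℕ) : ℝ) ^ c)‖
              ≤ C * X ^ ((2627349 : ℝ) / 2666036 + ε) := by
  refine ⟨1 / 10, by norm_num, fun ε hε hε1 A hA => ?_⟩
  set l := log (max A 1) with hl
  have hAl : A ≤ exp l := by
    rw [hl, Real.exp_log (by positivity)]
    exact le_max_left _ _
  have hl0 : 0 ≤ l := Real.log_nonneg (le_max_right _ _)
  obtain ⟨B, hB, x₀, hmain⟩ := exists_typeII_le c hc1 hc2 hc3 l hl0
  refine ⟨B * (A ^ 2 * (4 * exp l)), by positivity, exp (10000 / 9449 * (max x₀ 0 + l)),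
    fun P hP X M K hM hK hX1 _ hMK1 hMK2 hM1 hM2 ch hch a ha b hb α hα1 hα2 => ?_⟩
  have hP0 : 0 < P := (exp_pos _).trans_le hP
  have hX0 : 0 < X := lt_of_lt_of_le (by positivity) hX1
  obtain ⟨p, rfl⟩ : ∃ p, P = exp p := ⟨log P, (Real.exp_log hP0).symm⟩
  obtain ⟨x, rfl⟩ : ∃ x, X = exp x := ⟨log X, (Real.exp_log hX0).symm⟩
  obtain ⟨μ, rfl⟩ : ∃ μ, M = exp μ := ⟨log M, (Real.exp_log hM).symm⟩
  obtain ⟨κ, rfl⟩ : ∃ κ, K = exp κ := ⟨log K, (Real.exp_log hK).symm⟩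
  simp only [← Real.exp_mul] at hX1 hM1 hM2 hα1 hα2 ⊢
  have hupper : ∀ u v : ℝ, exp u ≤ A * exp v → u ≤ l + v := fun u v huv => by
    rw [← exp_le_exp, Real.exp_add]
    exact huv.trans (by gcongr)
  rw [inv_mul_le_iff₀ hA] at hX1 hMK1 hM1
  rw [← Real.exp_add] at hMK1 hMK2
  have hX1 := hupper _ _ hX1
  have hMK1 := hupper _ _ hMK1
  have hMK2' := hupper _ _ hMK2
  have hM1 := hupper _ _ hM1
  have hM2 := hupper _ _ hM2
  rw [exp_le_exp] at hP
  have hx : max x₀ 0 ≤ x := by linarith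
  have hx0 : 0 ≤ x := (le_max_right _ _).trans hx
  have h := hmain (Icc (-⌊exp (x * (38687 / 2666036))⌋) ⌊exp (x * (38687 / 2666036))⌋) ch a b α
    (exp (p * (1 - c - ε))) x μ κ (A * (2 * exp μ) ^ ε) (A * (2 * exp κ) ^ ε)
    ((le_max_left _ _).trans hx) (by linarith) (by linarith) (by linarith) (by linarith) hα1.le
    hα2.le ?_ ?_ (by positivity) (by positivity) (fun h _ => (hch h).trans (by gcongr)) ?_ ?_
  · refine h.trans ?_
    have e : (2 * exp μ) ^ ε * (2 * exp κ) ^ ε ≤ 4 * exp l * exp (x * ε) := by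
      have h1 : (1 : ℝ) ≤ 4 * exp l := by linarith [Real.one_le_exp hl0]
      calc (2 * exp μ) ^ ε * (2 * exp κ) ^ ε = (4 * exp (μ + κ)) ^ ε := by
            rw [← Real.mul_rpow (by positivity) (by positivity), Real.exp_add]
            congr 1
            ring
        _ ≤ (4 * exp l * exp x) ^ ε := by
            have h2 : exp (μ + κ) ≤ exp l * exp x := hMK2.trans (by gcongr)
            rw [mul_assoc]
            gcongr
        _ = (4 * exp l) ^ ε * exp (x * ε) := by
            rw [Real.mul_rpow (by positivity) (by positivity), Real.exp_mul]
        _ ≤ (4 * exp l) ^ (1 : ℝ) * exp (x * ε) := by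
            gcongr
            linarith
        _ = _ := by rw [Real.rpow_one]
    calc B * (A * (2 * exp μ) ^ ε * (A * (2 * exp κ) ^ ε) * exp (2627349 / 2666036 * x))
        = B * (A ^ 2 * ((2 * exp μ) ^ ε * (2 * exp κ) ^ ε) * exp (2627349 / 2666036 * x)) := by
          ring
      _ ≤ B * (A ^ 2 * (4 * exp l * exp (x * ε)) * exp (2627349 / 2666036 * x)) := by gcongr
      _ = _ := by
          rw [mul_add, Real.exp_add, mul_comm x (2627349 / 2666036)]
          ring
  · rw [exp_le_exp]
    have h1 : p * (c - 1 + ε) ≤ 10000 / 9449 * (x + l) * (c - 1 + ε) := by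
      gcongr
      linarith
    have h2 : 10000 / 9449 * (x + l) * (c - 1 + ε) ≤ 10000 / 9449 * (x + l) * (c - 9 / 10) := by
      gcongr
      linarith
    linarith
  · intro h hh
    obtain ⟨h1, h2⟩ := mem_Icc.1 hh
    have h3 : |h| ≤ ⌊exp (x * (38687 / 2666036))⌋ := abs_le.2 ⟨h1, h2⟩
    have h4 : |(h : ℝ)| ≤ (⌊exp (x * (38687 / 2666036))⌋ : ℝ) := by exact_mod_cast h3
    rw [mul_comm]
    exact h4.trans (Int.floor_le _)
  · intro m hm
    refine (ha m).trans ?_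
    have := (mem_Ioc_floor (exp_pos μ).le hm).2
    gcongr
  · intro k hk
    refine (hb k).trans ?_
    have := (mem_Ioc_floor (exp_pos κ).le hk).2
    gcongr
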